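/- arXiv:1202.0747 — 2 statements merged into one kernel-verified Lean document; each statement's English description precedes it below -/
import Mathlib

section
/- For every positive integer n, M(2,n) = 3n - 1. That is, over all acyclic directed graphs G with two distinct sources S_1, S_2 and two distinct sinks R_1, R_2 in which the min-cut from S_1 to R_1 is 2 and the min-cut from S_2 to R_2 is n, the largest possible value of the minimum number of mergings between a set of 2 edge-disjoint paths from S_1 to R_1 and a set of n edge-disjoint paths from S_2 to R_2 (minimized over all choices of the two Menger path systems) equals 3n - 1. -/
/-- A finite directed multigraph. -/
structure MultiDigraph where
  V : Type
  E : Type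
  fintV : Fintype V
  fintE : Fintype E
  src : E → V
  dst : E → V

namespace MultiDigraph

/-- `p` is a (nonempty) directed path from `u` to `v`, given as its list of edges. -/
def IsPathFrom (G : MultiDigraph) (u v : G.V) (p : List G.E) : Prop :=
  p ≠ [] ∧ List.Chain' (fun e f => G.dst e = G.src f) p ∧
    (∀ e ∈ p.head?, G.src e = u) ∧ ∀ e ∈ p.getLast?, G.dst e = v

/-- `G` is acyclic: there is no (nonempty) directed path from a vertex to itself. -/
def Acyclic (G : MultiDigraph) : Prop :=
  ∀ (v : G.V) (p : List G.E), ¬ G.IsPathFrom v v p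

/-- `α` is a family of `c` pairwise edge-disjoint directed paths from `u` to `v`. -/
def MengerSystem (G : MultiDigraph) (u v : G.V) (c : ℕ) (α : Fin c → List G.E) : Prop :=
  (∀ i, G.IsPathFrom u v (α i)) ∧ ∀ i j, i ≠ j → ∀ e, e ∈ α i → e ∉ α j

/-- The min-cut between `u` and `v` equals `c`: by Menger's theorem, this means the
maximum number of pairwise edge-disjoint directed paths from `u` to `v` is exactly `c`. -/
def MinCut (G : MultiDigraph) (u v : G.V) (c : ℕ) : Prop :=
  (∃ α : Fin c → List G.E, G.MengerSystem u v c α) ∧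
    ¬∃ α : Fin (c + 1) → List G.E, G.MengerSystem u v (c + 1) α

/-- Edge `e` is the starting edge of a merging among paths from (at least) two different
groups: `e` lies on a path of group `i` and on a path of group `j ≠ i`, and there are two
distinct edges immediately ahead of `e` on these two paths.  Mergings are counted without
multiplicity: one merging per such edge `e`. -/
def MergingEdge (G : MultiDigraph) {l : ℕ} {c : Fin l → ℕ}
    (α : (i : Fin l) → Fin (c i) → List G.E) (e : G.E) : Prop :=
  ∃ i j : Fin l, i ≠ j ∧ ∃ (a : Fin (c i)) (b : Fin (c j)) (f g : G.E),
    f ≠ g ∧ [f, e] <:+: α i a ∧ [g, e] <:+: α j b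

/-- The number of mergings among paths from different groups, `|G|_M(α₁,…,α_l)`. -/
noncomputable def mergingCount (G : MultiDigraph) {l : ℕ} {c : Fin l → ℕ}
    (α : (i : Fin l) → Fin (c i) → List G.E) : ℕ :=
  Set.ncard {e : G.E | G.MergingEdge α e}

end MultiDigraph

open MultiDigraph

/-- `G` is a finite acyclic directed multigraph with designated sources `S i`, pairwise
distinct sinks `R i`, and min-cut `c i` between `S i` and `R i`. -/
def GoodConfig {l : ℕ} (G : MultiDigraph) (S R : Fin l → G.V) (c : Fin l → ℕ) : Prop :=
  G.Acyclic ∧ Function.Injective R ∧ ∀ i, G.MinCut (S i) (R i) (c i)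

/-- `M(c₁,…,c_l) ≤ B`: in every acyclic graph with distinct sources, distinct sinks and
the given min-cuts, some choice of Menger path systems yields at most `B` mergings. -/
def MAtMost {l : ℕ} (c : Fin l → ℕ) (B : ℕ) : Prop :=
  ∀ (G : MultiDigraph) (S R : Fin l → G.V), GoodConfig G S R c → Function.Injective S →
    ∃ α : (i : Fin l) → Fin (c i) → List G.E,
      (∀ i, G.MengerSystem (S i) (R i) (c i) (α i)) ∧ G.mergingCount α ≤ B

/-- `M(c₁,…,c_l) ≥ B`: some acyclic graph with distinct sources, distinct sinks and the
given min-cuts yields at least `B` mergings for every choice of Menger path systems. -/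
def MAtLeast {l : ℕ} (c : Fin l → ℕ) (B : ℕ) : Prop :=
  ∃ (G : MultiDigraph) (S R : Fin l → G.V), GoodConfig G S R c ∧ Function.Injective S ∧
    ∀ α : (i : Fin l) → Fin (c i) → List G.E,
      (∀ i, G.MengerSystem (S i) (R i) (c i) (α i)) → B ≤ G.mergingCount α

/-- `M(c₁,…,c_l) = B`: the largest possible value, over all acyclic graphs with distinct
sources and distinct sinks realizing the min-cuts `c`, of the minimum number of mergings
over all choices of Menger path systems, equals `B`. -/
def MEq {l : ℕ} (c : Fin l → ℕ) (B : ℕ) : Prop := MAtMost c B ∧ MAtLeast c B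

/-- `M*(c₁,…,c_l) ≤ B`: as `MAtMost`, but with all sources identical. -/
def MstarAtMost {l : ℕ} (c : Fin l → ℕ) (B : ℕ) : Prop :=
  ∀ (G : MultiDigraph) (S R : Fin l → G.V), GoodConfig G S R c → (∀ i j, S i = S j) →
    ∃ α : (i : Fin l) → Fin (c i) → List G.E,
      (∀ i, G.MengerSystem (S i) (R i) (c i) (α i)) ∧ G.mergingCount α ≤ B

/-- `M*(c₁,…,c_l) ≥ B`: as `MAtLeast`, but with all sources identical. -/
def MstarAtLeast {l : ℕ} (c : Fin l → ℕ) (B : ℕ) : Prop :=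
  ∃ (G : MultiDigraph) (S R : Fin l → G.V), GoodConfig G S R c ∧ (∀ i j, S i = S j) ∧
    ∀ α : (i : Fin l) → Fin (c i) → List G.E,
      (∀ i, G.MengerSystem (S i) (R i) (c i) (α i)) → B ≤ G.mergingCount α

/-- `M*(c₁,…,c_l) = B`: as `MEq`, but with all sources identical. -/
def MstarEq {l : ℕ} (c : Fin l → ℕ) (B : ℕ) : Prop := MstarAtMost c B ∧ MstarAtLeast c B


set_option linter.unusedSectionVars false

namespace MTN

/-- consecutive points on the same path -/
def Cons {Pt ι : Type} (t : Pt → ℕ) (a : Pt → ι) (e f : Pt) : Prop :=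
  a e = a f ∧ t e < t f ∧ ∀ g, a g = a e → t g ≤ t e ∨ t f ≤ t g

/-- no rerouting of the `a`-paths along `b`-segments -/
def NoRR {Pt ι κ : Type} (t : Pt → ℕ) (a : Pt → ι) (b : Pt → κ) : Prop :=
  ∀ (K : Finset Pt) (u π : Pt → Pt), K.Nonempty → Set.InjOn a K →
    (∀ d ∈ K, Cons t b d (u d)) →
    (∀ d ∈ K, π d ∈ K ∧ a (π d) = a (u d) ∧ t (π d) < t (u d)) →
    Set.InjOn π K → False

section
variable {Pt ι : Type} {t : Pt → ℕ} {a : Pt → ι}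

theorem exists_succ [Fintype Pt] {e f : Pt} (h : a e = a f) (ht : t e < t f) :
    ∃ s, Cons t a e s ∧ t s ≤ t f := by
  classical
  obtain ⟨s, hs, hm⟩ := Finset.exists_min_image
    (Finset.univ.filter (fun g => a g = a e ∧ t e < t g)) t ⟨f, by simp [h, ht]⟩
  simp only [Finset.mem_filter, Finset.mem_univ, true_and] at hs hm
  refine ⟨s, ⟨hs.1.symm, hs.2, fun g hg => ?_⟩, hm f ⟨h.symm, ht⟩⟩
  by_cases hh : t g ≤ t e
  · exact Or.inl hh
  · exact Or.inr (hm g ⟨hg, by omega⟩)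

theorem exists_pred [Fintype Pt] {e f : Pt} (h : a e = a f) (ht : t e < t f) :
    ∃ s, Cons t a s f ∧ t e ≤ t s := by
  classical
  obtain ⟨s, hs, hm⟩ := Finset.exists_max_image
    (Finset.univ.filter (fun g => a g = a f ∧ t g < t f)) t ⟨e, by simp [h, ht]⟩
  simp only [Finset.mem_filter, Finset.mem_univ, true_and] at hs hm
  refine ⟨s, ⟨hs.1, hs.2, fun g hg => ?_⟩, hm e ⟨h, ht⟩⟩
  by_cases hh : t f ≤ t g
  · exact Or.inr hh
  · exact Or.inl (hm g ⟨hg.trans hs.1, by omega⟩)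

theorem Cons.right_unique (inj : ∀ e f, a e = a f → t e = t f → e = f) {e f g : Pt}
    (h : Cons t a e f) (h' : Cons t a e g) : f = g := by
  apply inj
  · rw [← h.1, h'.1]
  · have := h.2.2 g h'.1.symm
    have := h'.2.2 f h.1.symm
    have := h.2.1; have := h'.2.1
    omega

theorem Cons.left_unique (inj : ∀ e f, a e = a f → t e = t f → e = f) {e f g : Pt}
    (h : Cons t a f e) (h' : Cons t a g e) : f = g := by
  apply inj
  · rw [h.1, h'.1]
  · have := h.2.2 g (h'.1.trans h.1.symm)
    have := h'.2.2 f (h.1.trans h'.1.symm)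
    have := h.2.1; have := h'.2.1
    omega
end

theorem fin2_eq {p q r : Fin 2} (h : p ≠ q) (h' : r ≠ q) : p = r := by omega

section main
variable {Pt : Type} [Fintype Pt] {n : ℕ} {t : Pt → ℕ} {a : Pt → Fin 2} {b : Pt → Fin n}

theorem alt (h1 : NoRR t a b) {e f : Pt} (h : Cons t b e f) : a e ≠ a f := by
  intro hh
  refine h1 {e} (fun _ => f) id (by simp) (by simp) (by simpa using h) ?_ (by simp)
  simpa using ⟨hh, h.2.1⟩

theorem noswap (h1 : NoRR t a b) {p q c d : Pt} (h : Cons t b p q) (h' : Cons t b c d)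
    (e1 : a p = a d) (e2 : a q = a c) (l1 : t c < t q) (l2 : t p < t d) : False := by
  classical
  have hne : a p ≠ a q := alt h1 h
  have hpc : p ≠ c := by rintro rfl; exact hne e2.symm
  refine h1 {p, c} (fun x => if x = p then q else d) (fun x => if x = p then c else p)
    (by simp) ?_ ?_ ?_ ?_
  · intro x hx y hy hxy
    simp only [Finset.coe_insert, Finset.coe_singleton, Set.mem_insert_iff,
      Set.mem_singleton_iff] at hx hy
    rcases hx with rfl | rfl <;> rcases hy with rfl | rfl
    · rfl
    · exact absurd (hxy.trans e2.symm) hne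
    · exact absurd (hxy.symm.trans e2.symm) hne
    · rfl
  · intro x hx
    simp only [Finset.mem_insert, Finset.mem_singleton] at hx
    rcases hx with rfl | rfl
    · simpa using h
    · simpa [hpc.symm] using h'
  · intro x hx
    simp only [Finset.mem_insert, Finset.mem_singleton] at hx
    rcases hx with rfl | rfl
    · simp [e2, l1]
    · simp [hpc.symm, e1, l2]
  · intro x hx y hy hxy
    simp only [Finset.coe_insert, Finset.coe_singleton, Set.mem_insert_iff,
      Set.mem_singleton_iff] at hx hy
    rcases hx with rfl | rfl <;> rcases hy with rfl | rfl
    · rfl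
    · simp [hpc.symm] at hxy
    · simp [hpc.symm] at hxy
      exact absurd hxy hpc
    · rfl

variable (ib : ∀ e f, b e = b f → t e = t f → e = f)
variable (ia : ∀ e f, a e = a f → t e = t f → e = f)

include ib ia in
theorem U1 (h1 : NoRR t a b) {w x z u u' : Pt} (hw : Cons t b w x) (hz : Cons t b x z)
    (hu : a u = a w) (l1 : t w < t u) (l2 : t u < t z) (h : Cons t b u' u) :
    a u' = a x ∧ t x < t u' ∧ (∀ y, ¬ Cons t b y u') ∧ (∀ y, ¬ Cons t b u y) := by
  have awx := alt h1 hw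
  have axz := alt h1 hz
  have au := alt h1 h
  have e1 : a u' = a x := by rw [hu] at au; exact fin2_eq au awx.symm
  have k1 : t x < t u' := by
    rcases lt_trichotomy (t u') (t x) with hl | hl | hl
    · exact (noswap h1 h hw e1 hu l1 hl).elim
    · have := ia _ _ e1 hl
      subst this
      have := h.right_unique ib hz
      subst this; omega
    · exact hl
  have := h.2.1
  refine ⟨e1, k1, fun y hy => ?_, fun y hy => ?_⟩
  · have ay := alt h1 hy
    rw [e1] at ay
    have := hy.2.1
    exact noswap h1 hz hy e1.symm (fin2_eq axz.symm ay) (by omega) k1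
  · have ay := alt h1 hy
    have := hy.2.1
    refine noswap h1 hz hy ?_ ?_ l2 (by omega)
    · rw [hu] at ay; exact fin2_eq awx.symm ay.symm
    · rw [hu]; exact fin2_eq axz.symm awx

include ib ia in
theorem U2 (h1 : NoRR t a b) {w x z u v : Pt} (hw : Cons t b w x) (hz : Cons t b x z)
    (hu : a u = a w) (l1 : t w < t u) (l2 : t u < t z) (h : Cons t b u v) :
    t v < t x ∧ (∀ y, ¬ Cons t b v y) := by
  have awx := alt h1 hw
  have axz := alt h1 hz
  have au := alt h1 h
  have e1 : a v = a x := by rw [hu] at au; exact fin2_eq au.symm awx.symm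
  have k1 : t v < t x := by
    rcases lt_trichotomy (t x) (t v) with hl | hl | hl
    · exact (noswap h1 hz h e1.symm (by rw [hu]; exact fin2_eq axz.symm awx) l2 hl).elim
    · have := ia _ _ e1 hl.symm
      subst this
      have := h.left_unique ib hw
      subst this; omega
    · exact hl
  refine ⟨k1, fun y hy => ?_⟩
  have ay := alt h1 hy
  have := hy.2.1
  have := h.2.1
  rw [e1] at ay
  exact noswap h1 hy hw e1 (fin2_eq ay.symm awx) (by omega) k1

def Intl (t : Pt → ℕ) (b : Pt → Fin n) (x : Pt) : Prop := (∃ w, Cons t b w x) ∧ ∃ z, Cons t b x z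

include ib ia in
/-- the `b`-path of a point strictly between is short -/
theorem short (h1 : NoRR t a b) {w x z u : Pt} (hw : Cons t b w x) (hz : Cons t b x z)
    (hu : a u = a w) (l1 : t w < t u) (l2 : t u < t z) :
    ∀ y, b y = b u → ¬ Intl t b y := by
  rintro y hy ⟨⟨p, hp⟩, ⟨q, hq⟩⟩
  rcases lt_trichotomy (t y) (t u) with hl | hl | hl
  · obtain ⟨u', h', hle⟩ := exists_pred hy hl
    obtain ⟨-, -, k, -⟩ := U1 ib ia h1 hw hz hu l1 l2 h'
    obtain ⟨r, hr, -⟩ := exists_pred (a := b) (t := t) (e := p) (f := u')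
      (by rw [h'.1, ← hy, hp.1]) (by have := hp.2.1; omega)
    exact k r hr
  · have := ib _ _ hy hl
    subst this
    exact (U1 ib ia h1 hw hz hu l1 l2 hp).2.2.2 q hq
  · obtain ⟨v, h', hle⟩ := exists_succ hy.symm hl
    obtain ⟨-, k⟩ := U2 ib ia h1 hw hz hu l1 l2 h'
    obtain ⟨r, hr, -⟩ := exists_succ (a := b) (t := t) (e := v) (f := q)
      (by rw [← h'.1, ← hy, hq.1]) (by have := hq.2.1; omega)
    exact k r hr

inductive Ch (t : Pt → ℕ) (a : Pt → Fin 2) (b : Pt → Fin n) : Pt → Pt → Prop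
  | base (w x : Pt) : Cons t b w x → Intl t b x → Ch t a b w x
  | step (d x u u' z : Pt) : Ch t a b d x → Cons t a d u → Cons t b u' u → Cons t b x z →
      Intl t b z → Ch t a b u' z

/-- the chain invariant -/
def ChInv (t : Pt → ℕ) (a : Pt → Fin 2) (b : Pt → Fin n) (d x : Pt) : Prop :=
  ∃ w z, Cons t b w x ∧ Cons t b x z ∧ a d = a w ∧ t w ≤ t d ∧ t d < t z ∧
    (d = w ∨ ∃ v, Cons t b d v) ∧
    ∃ (K : Finset Pt) (k0 : Pt), d ∈ K ∧ k0 ∈ K ∧ b k0 = b x ∧ t k0 < t x ∧ Set.InjOn b K ∧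
      (∀ e ∈ K, e ≠ k0 → ∀ g, b g = b e → t e ≤ t g) ∧
      (∀ e ∈ K, e ≠ d → ∃ f e', Cons t a e f ∧ e' ∈ K ∧ e' ≠ k0 ∧ Cons t b e' f)

include ib ia in
theorem ChInv.next (h2 : NoRR t b a) {d x w z : Pt} (h : ChInv t a b d x)
    (h1 : NoRR t a b) (hw : Cons t b w x) (hz : Cons t b x z) :
    ∃ f, Cons t a d f ∧ a f = a w ∧ t w < t f ∧ t f < t z := by
  classical
  obtain ⟨w, z, hw', hz', ad, l1, l2, -, K, k0, hdK, hk0, bk, lk, iK, -, hK⟩ := h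
  obtain rfl := hw'.left_unique ib hw
  obtain rfl := hz'.right_unique ib hz
  have awz : a w = a z := fin2_eq (alt h1 hw) (alt h1 hz).symm
  obtain ⟨f, hf, hle⟩ := exists_succ (a := a) (t := t) (ad.trans awz) l2
  refine ⟨f, hf, by rw [← hf.1, ad], by have := hf.2.1; omega, ?_⟩
  refine lt_of_le_of_ne hle fun hEq => ?_
  have : f = z := ia _ _ (by rw [← hf.1, ad, awz]) hEq
  subst this
  choose! F E' hF hE hE0 hEF using hK
  refine h2 K (fun e => if e = d then f else F e) (fun e => if e = d then k0 else E' e)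
    ⟨d, hdK⟩ iK ?_ ?_ ?_
  · intro e he
    by_cases hed : e = d
    · subst hed; simpa using hf
    · simpa [hed] using hF e he hed
  · intro e he
    by_cases hed : e = d
    · subst hed
      have := hz.2.1
      simp [hk0, bk, hz.1]; omega
    · simp only [hed, if_false]
      exact ⟨hE e he hed, (hEF e he hed).1, (hEF e he hed).2.1⟩
  · intro e he g hg heg
    by_cases hed : e = d <;> by_cases hgd : g = d
    · rw [hed, hgd]
    · simp only [hed, hgd, if_true, if_false] at heg
      exact absurd heg.symm (hE0 g hg hgd)
    · simp only [hed, hgd, if_true, if_false] at heg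
      exact absurd heg (hE0 e he hed)
    · simp only [hed, hgd, if_false] at heg
      have e1 := hEF e he hed
      have e2 := hEF g hg hgd
      rw [heg] at e1
      have e3 := e1.right_unique ib e2
      have e4 := hF e he hed
      have e5 := hF g hg hgd
      rw [e3] at e4
      exact e4.left_unique ia e5

include ib ia in
theorem Ch.inv (h1 : NoRR t a b) (h2 : NoRR t b a) {d x : Pt} (h : Ch t a b d x) :
    ChInv t a b d x := by
  classical
  induction h with
  | base w x hw hx =>
    obtain ⟨-, z, hz⟩ := hx
    exact ⟨w, z, hw, hz, rfl, le_rfl, hw.2.1.trans hz.2.1, Or.inl rfl, {w}, w, by simp, by simp,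
      hw.1, hw.2.1, by simp, by simp, by simp⟩
  | step d x u u' z hc hdu hu hz hi ih =>
    have ih0 := ih
    obtain ⟨w, z', hw, hz', ad, l1, l2, -, K, k0, hdK, hk0, bk, lk, iK, fK, hK⟩ := ih
    obtain rfl := hz'.right_unique ib hz
    obtain ⟨f, hf, af, lf1, lf2⟩ := ih0.next ib ia h2 h1 hw hz
    obtain rfl := hf.right_unique ia hdu
    obtain ⟨e1, k1, np, -⟩ := U1 ib ia h1 hw hz af lf1 lf2 hu
    obtain ⟨-, z2, hz2⟩ := hi
    have k2 := hu.2.1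
    have k3 := hz2.2.1
    have first : ∀ g, b g = b u' → t u' ≤ t g := by
      intro g hg
      by_contra hlt
      obtain ⟨r, hr, -⟩ := exists_pred (t := t) hg (by omega)
      exact np r hr
    have bx : b x ≠ b u' := fun hb => by have := first x hb; omega
    refine ⟨x, z2, hz, hz2, e1, k1.le, by omega, Or.inr ⟨_, hu⟩, insert u' K, k0, by simp,
      by simp [hk0], by rw [bk, hz.1], lk.trans hz.2.1, ?_, ?_, ?_⟩
    · have key : ∀ e ∈ K, b u' = b e → u' = e := by
        intro e he hb
        by_cases hek : e = k0
        · subst hek; exact absurd (bk.symm.trans hb.symm) bx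
        · exact ib _ _ hb (le_antisymm (first e hb.symm) (fK e he hek u' hb))
      intro e he g hg hb
      simp only [Finset.coe_insert, Set.mem_insert_iff, Finset.mem_coe] at he hg
      rcases he with rfl | he <;> rcases hg with rfl | hg
      · rfl
      · exact key g hg hb
      · exact (key e he hb.symm).symm
      · exact iK he hg hb
    · intro e he hne
      rcases Finset.mem_insert.1 he with rfl | he
      · exact first
      · exact fK e he hne
    · intro e he hne
      rcases Finset.mem_insert.1 he with rfl | he
      · exact absurd rfl hne
      · by_cases hed : e = d
        · subst hed
          exact ⟨f, u', hdu, by simp, fun hh => bx (by rw [hh, bk]), hu⟩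
        · obtain ⟨f, e', q1, q2, q3, q4⟩ := hK e he hed
          exact ⟨f, e', q1, by simp [q2], q3, q4⟩

include ib ia in
theorem Ch.data (h1 : NoRR t a b) (h2 : NoRR t b a) {d x : Pt} (h : Ch t a b d x) :
    ∃ w z f, Cons t b w x ∧ Cons t b x z ∧ Cons t a d f ∧ a f = a w ∧ t w < t f ∧ t f < t z ∧
      a d = a w ∧ t w ≤ t d ∧ (d = w ∨ ∃ v, Cons t b d v) := by
  have hi := h.inv ib ia h1 h2
  obtain ⟨w, z, hw, hz, ad, l1, l2, hd, -⟩ := id hi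
  obtain ⟨f, hf, af, lf1, lf2⟩ := hi.next ib ia h2 h1 hw hz
  exact ⟨w, z, f, hw, hz, hf, af, lf1, lf2, ad, l1, hd⟩

/-- escape data -/
def Esc (t : Pt → ℕ) (a : Pt → Fin 2) (b : Pt → Fin n) (f x : Pt) : Prop :=
  ∃ d w z u', Cons t b w x ∧ Cons t b x z ∧ ¬ Intl t b z ∧ Cons t a d f ∧ a f = a w ∧
    t w < t f ∧ t f < t z ∧ a d = a w ∧ t w ≤ t d ∧ (d = w ∨ ∃ v, Cons t b d v) ∧ Cons t b u' f

include ib in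
theorem last_unique {x x' z z' : Pt} (hx : Intl t b x) (hx' : Intl t b x') (hb : b x = b x')
    (hz : Cons t b x z) (hz' : Cons t b x' z') (n1 : ¬ Intl t b z) (n2 : ¬ Intl t b z') :
    x = x' := by
  have key : ∀ x x' z : Pt, Intl t b x' → b x = b x' → Cons t b x z → ¬ Intl t b z →
      ¬ t x < t x' := by
    intro x x' z hx' hb hz n1 hl
    obtain ⟨-, q, hq⟩ := hx'
    have := hz.2.2 x' hb.symm
    obtain ⟨r, hr, -⟩ := exists_succ (a := b) (t := t) (e := z) (f := q)
      (by rw [← hz.1, hb, hq.1]) (by have := hq.2.1; omega)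
    exact n1 ⟨⟨x, hz⟩, r, hr⟩
  have k1 := key x x' z hx' hb hz n1
  have k2 := key x' x z' hx hb.symm hz' n2
  exact ib _ _ hb (by omega)

include ib ia in
theorem esc_inj (h1 : NoRR t a b) {f f' x : Pt} (h : Esc t a b f x) (h' : Esc t a b f' x) :
    f = f' := by
  have key : ∀ f f' : Pt, Esc t a b f x → Esc t a b f' x → ¬ t f < t f' := by
    rintro f f' ⟨d, w, z, u', hw, hz, -, hd, af, l1, l2, ad, l3, hdw, hu⟩
      ⟨d', w', z', u1, hw', hz', -, hd', af', l1', l2', ad', l3', hdw', hu'⟩ hl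
    obtain rfl := hw'.left_unique ib hw
    obtain rfl := hz'.right_unique ib hz
    have k1 := hd'.2.2 f (by rw [af, ad'])
    have k2 := hd.2.1
    have k3 := hd'.2.1
    rcases hdw' with rfl | ⟨v, hv⟩
    · omega
    · have q1 := (U1 ib ia h1 hw hz af l1 l2 hu).2.1
      have q2 := (U2 ib ia h1 hw hz ad' (by omega) (by omega) hv).1
      have := hv.2.1
      have := hu.2.1
      omega
  have k1 := key f f' h h'
  have k2 := key f' f h' h
  obtain ⟨d, w, z, u', hw, hz, -, hd, af, -⟩ := h
  obtain ⟨d', w', z', u1, hw', hz', -, hd', af', -⟩ := h'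
  obtain rfl := hw'.left_unique ib hw
  exact ia _ _ (by rw [af, af']) (by omega)

include ib ia in
theorem intl_card (hn : 0 < n) (h1 : NoRR t a b) (h2 : NoRR t b a) (I : Finset Pt)
    (hI : ∀ x, x ∈ I ↔ Intl t b x) : I.card + 1 ≤ n := by
  classical
  by_contra hcon
  let C : Finset Pt := Finset.univ.filter (fun d => ∃ x, Ch t a b d x)
  have hC : ∀ d, d ∈ C ↔ ∃ x, Ch t a b d x := by simp [C]
  have hs : ∀ d ∈ C, ∃ f, Cons t a d f := by
    intro d hd
    obtain ⟨x, hx⟩ := (hC d).1 hd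
    obtain ⟨w, z, f, -, -, hf, -⟩ := hx.data ib ia h1 h2
    exact ⟨f, hf⟩
  choose! s hs using hs
  have cA : (C.image s).card = C.card := by
    apply Finset.card_image_of_injOn
    intro d hd d' hd' hh
    have q1 := hs d hd
    have q2 := hs d' hd'
    rw [← hh] at q2
    exact q1.left_unique ia q2
  have hA : ∀ f ∈ C.image s, ∃ d x w z, Ch t a b d x ∧ Cons t b w x ∧ Cons t b x z ∧
      Cons t a d f ∧ a f = a w ∧ t w < t f ∧ t f < t z ∧
      a d = a w ∧ t w ≤ t d ∧ (d = w ∨ ∃ v, Cons t b d v) := by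
    intro f hf
    obtain ⟨d, hd, rfl⟩ := Finset.mem_image.1 hf
    obtain ⟨x, hx⟩ := (hC d).1 hd
    obtain ⟨w, z, f, q1, q2, hf, q3⟩ := hx.data ib ia h1 h2
    obtain rfl := hf.right_unique ia (hs d hd)
    exact ⟨d, x, w, z, hx, q1, q2, hf, q3⟩
  let T := (C.image s).filter (fun f => ¬ ∃ u', Cons t b u' f)
  let En := (C.image s).filter (fun f => ∃ u', Cons t b u' f)
  have cTE : En.card + T.card = (C.image s).card := Finset.card_filter_add_card_filter_not _
  let E1 := En.filter (fun f => ∃ u', Cons t b u' f ∧ u' ∈ C)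
  let E2 := En.filter (fun f => ¬ ∃ u', Cons t b u' f ∧ u' ∈ C)
  have cE : E1.card + E2.card = En.card := Finset.card_filter_add_card_filter_not _
  have hp : ∀ x ∈ I, ∃ w, Cons t b w x := fun x hx => ((hI x).1 hx).1
  choose! p hp using hp
  have cX : (I.image p).card = I.card := by
    apply Finset.card_image_of_injOn
    intro d hd d' hd' hh
    have q1 := hp d hd
    have q2 := hp d' hd'
    rw [← hh] at q2
    exact q1.right_unique ib q2
  have XC : I.image p ⊆ C := by
    intro w hw
    obtain ⟨x, hx, rfl⟩ := Finset.mem_image.1 hw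
    exact (hC _).2 ⟨x, Ch.base _ _ (hp x hx) ((hI x).1 hx)⟩
  have cE1 : E1.card ≤ (C \ I.image p).card := by
    have hq : ∀ f ∈ E1, ∃ u', Cons t b u' f ∧ u' ∈ C := fun f hf => (Finset.mem_filter.1 hf).2
    choose! q hq using hq
    refine Finset.card_le_card_of_injOn q ?_ ?_
    · intro f hf
      have hf' : f ∈ E1 := hf
      have hfA : f ∈ C.image s := (Finset.mem_filter.1 (Finset.mem_filter.1 hf').1).1
      obtain ⟨d, x, w, z, -, q1, q2, -, q4, q5, q6, -⟩ := hA f hfA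
      have hsh := short ib ia h1 q1 q2 q4 q5 q6
      simp only [Finset.coe_sdiff, Set.mem_sdiff, Finset.mem_coe]
      refine ⟨(hq f hf').2, fun hX => ?_⟩
      obtain ⟨y, hy, hpy⟩ := Finset.mem_image.1 hX
      have r1 := hp y hy
      rw [hpy] at r1
      have := r1.right_unique ib (hq f hf').1
      subst this
      exact hsh y rfl ((hI y).1 hy)
    · intro f hf f' hf' hh
      have q1 := (hq f hf).1
      have q2 := (hq f' hf').1
      rw [← hh] at q2
      exact q1.right_unique ib q2
  have hE2 : ∀ f ∈ E2, ∃ x, x ∈ I ∧ Esc t a b f x := by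
    intro f hf
    obtain ⟨hfE, hno⟩ := Finset.mem_filter.1 hf
    obtain ⟨hfA, u', hu'⟩ := Finset.mem_filter.1 hfE
    obtain ⟨d, x, w, z, q0, q1, q2, q3, q4, q5, q6, q7, q8, q9⟩ := hA f hfA
    refine ⟨x, (hI x).2 ⟨⟨w, q1⟩, z, q2⟩, d, w, z, u', q1, q2, fun hz => ?_, q3, q4, q5, q6,
      q7, q8, q9, hu'⟩
    exact hno ⟨u', hu', (hC u').2 ⟨z, Ch.step d x f u' z q0 q3 hu' q2 hz⟩⟩
  choose! xo hxI hxE using hE2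
  have injE2 : Set.InjOn (fun f => b (xo f)) E2 := by
    intro f hf f' hf' hh
    have q1 := hxE f hf
    have q2 := hxE f' hf'
    have : xo f = xo f' := by
      obtain ⟨d, w, z, u', -, hz, nz, -⟩ := id q1
      obtain ⟨d', w', z', u1, -, hz', nz', -⟩ := id q2
      exact last_unique ib ((hI _).1 (hxI f hf)) ((hI _).1 (hxI f' hf')) hh hz hz' nz nz'
    rw [← this] at q2
    exact esc_inj ib ia h1 q1 q2
  let Ru := I.image b
  have imE2 : E2.image (fun f => b (xo f)) ⊆ Ru := by
    intro k hk
    obtain ⟨f, hf, rfl⟩ := Finset.mem_image.1 hk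
    exact Finset.mem_image_of_mem _ (hxI f hf)
  have cE2 : (E2.image (fun f => b (xo f))).card = E2.card := Finset.card_image_of_injOn injE2
  have imT : T.image b ⊆ Ruᶜ := by
    intro k hk
    obtain ⟨f, hf, rfl⟩ := Finset.mem_image.1 hk
    obtain ⟨d, x, w, z, -, q1, q2, -, q4, q5, q6, -⟩ := hA f (Finset.mem_filter.1 hf).1
    have hsh := short ib ia h1 q1 q2 q4 q5 q6
    rw [Finset.mem_compl]
    intro hR
    obtain ⟨y, hy, hyb⟩ := Finset.mem_image.1 hR
    exact hsh y hyb ((hI y).1 hy)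
  have cT : (T.image b).card = T.card := by
    apply Finset.card_image_of_injOn
    intro f hf f' hf' hh
    have n1 := (Finset.mem_filter.1 hf).2
    have n2 := (Finset.mem_filter.1 hf').2
    rcases lt_trichotomy (t f) (t f') with hl | hl | hl
    · obtain ⟨r, hr, -⟩ := exists_pred hh hl
      exact absurd ⟨r, hr⟩ n2
    · exact ib _ _ hh hl
    · obtain ⟨r, hr, -⟩ := exists_pred hh.symm hl
      exact absurd ⟨r, hr⟩ n1
  have c1 := Finset.card_le_card imE2
  have c2 := Finset.card_le_card imT
  have c3 : Ru.card + Ruᶜ.card = n := by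
    rw [Finset.card_add_card_compl]; simp
  have c4 : (C \ I.image p).card + (I.image p).card = C.card :=
    Finset.card_sdiff_add_card_eq_card XC
  have eq1 : E2.image (fun f => b (xo f)) = Ru := Finset.eq_of_subset_of_card_le imE2 (by omega)
  have eq2 : T.image b = Ruᶜ := Finset.eq_of_subset_of_card_le imT (by omega)
  -- the maximal internal rung
  have hne : I.Nonempty := by
    rw [← Finset.card_pos]; omega
  have hz0 : ∀ x ∈ I, ∃ z, Cons t b x z := fun x hx => ((hI x).1 hx).2
  choose! ζ hζ using hz0
  obtain ⟨x, hx, hmax⟩ := Finset.exists_max_image I (fun x => t x + t (ζ x)) hne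
  have nz : ¬ Intl t b (ζ x) := by
    intro hz
    have hzI := (hI _).2 hz
    have k1 := hmax _ hzI
    have k2 := (hζ _ hzI).2.1
    have k3 := (hζ _ hx).2.1
    omega
  have hbR : b x ∈ E2.image (fun f => b (xo f)) := by
    rw [eq1]; exact Finset.mem_image_of_mem _ hx
  obtain ⟨f, hf, hfx⟩ := Finset.mem_image.1 hbR
  have hesc := hxE f hf
  have hxo : xo f = x := by
    obtain ⟨d, w, z, u', -, hz, nz', -⟩ := id hesc
    exact last_unique ib ((hI _).1 (hxI f hf)) ((hI _).1 hx) hfx hz (hζ x hx) nz' nz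
  rw [hxo] at hesc
  obtain ⟨d, w, z, u', hw, hz, -, -, af, l1, l2, -, -, -, hu⟩ := hesc
  obtain rfl := hz.right_unique ib (hζ x hx)
  obtain ⟨au, lu, np, -⟩ := U1 ib ia h1 hw hz af l1 l2 hu
  have hsh := short ib ia h1 hw hz af l1 l2
  have hbS : b u' ∈ T.image b := by
    rw [eq2, Finset.mem_compl]
    intro hR
    obtain ⟨y, hy, hyb⟩ := Finset.mem_image.1 hR
    exact hsh y (hyb.trans hu.1) ((hI y).1 hy)
  obtain ⟨τ, hτ, hτb⟩ := Finset.mem_image.1 hbS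
  obtain ⟨hτA, hτn⟩ := Finset.mem_filter.1 hτ
  have : τ = u' := by
    rcases lt_trichotomy (t τ) (t u') with hl | hl | hl
    · obtain ⟨r, hr, -⟩ := exists_pred hτb hl
      exact absurd hr (np r)
    · exact ib _ _ hτb hl
    · obtain ⟨r, hr, -⟩ := exists_pred hτb.symm hl
      exact absurd ⟨r, hr⟩ hτn
  subst this
  obtain ⟨d', y, w', z', -, q1, q2, -, q4, q5, q6, -⟩ := hA τ hτA
  have hyI : y ∈ I := (hI y).2 ⟨⟨w', q1⟩, z', q2⟩
  have hzy : ζ y = z' := (hζ y hyI).right_unique ib q2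
  have k := hmax y hyI
  rw [hzy] at k
  have a1 := alt h1 q1
  have a2 := alt h1 q2
  have a3 := alt h1 hz
  have e1 : a x = a z' := by
    rw [← au, q4]; exact fin2_eq a1 a2.symm
  have e2 : a (ζ x) = a y := by
    rw [← e1] at a2; exact fin2_eq a3.symm a2
  have : ¬ t y < t (ζ x) := fun hh => noswap h1 hz q2 e1 e2 hh (by omega)
  omega

include ib ia in
theorem count (hn : 0 < n) (h1 : NoRR t a b) (h2 : NoRR t b a) :
    Fintype.card Pt ≤ 3 * n - 1 := by
  classical
  let I : Finset Pt := Finset.univ.filter (fun x => Intl t b x)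
  have hI := intl_card ib ia hn h1 h2 I (by simp [I])
  let F : Finset Pt := Finset.univ.filter (fun x => ¬ ∃ w, Cons t b w x)
  let G : Finset Pt := Finset.univ.filter (fun x => ¬ ∃ w, Cons t b x w)
  have cF : F.card ≤ n := by
    rw [← Fintype.card_fin n]
    refine Finset.card_le_card_of_injOn (t := Finset.univ) b (by simp) ?_
    intro f hf f' hf' hh
    have n1 := (Finset.mem_filter.1 hf).2
    have n2 := (Finset.mem_filter.1 hf').2
    rcases lt_trichotomy (t f) (t f') with hl | hl | hl
    · obtain ⟨r, hr, -⟩ := exists_pred hh hl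
      exact absurd ⟨r, hr⟩ n2
    · exact ib _ _ hh hl
    · obtain ⟨r, hr, -⟩ := exists_pred hh.symm hl
      exact absurd ⟨r, hr⟩ n1
  have cG : G.card ≤ n := by
    rw [← Fintype.card_fin n]
    refine Finset.card_le_card_of_injOn (t := Finset.univ) b (by simp) ?_
    intro f hf f' hf' hh
    have n1 := (Finset.mem_filter.1 hf).2
    have n2 := (Finset.mem_filter.1 hf').2
    rcases lt_trichotomy (t f) (t f') with hl | hl | hl
    · obtain ⟨r, hr, -⟩ := exists_succ hh hl
      exact absurd ⟨r, hr⟩ n1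
    · exact ib _ _ hh hl
    · obtain ⟨r, hr, -⟩ := exists_succ hh.symm hl
      exact absurd ⟨r, hr⟩ n2
  have hcov : (Finset.univ : Finset Pt) ⊆ I ∪ (F ∪ G) := by
    intro x _
    have m1 : x ∈ I ↔ Intl t b x := by simp [I]
    have m2 : x ∈ F ↔ ¬ ∃ w, Cons t b w x := by simp [F]
    have m3 : x ∈ G ↔ ¬ ∃ w, Cons t b x w := by simp [G]
    rw [Finset.mem_union, Finset.mem_union, m1, m2, m3, Intl]
    tauto
  have c1 := Finset.card_le_card hcov
  have c2 := Finset.card_union_le I (F ∪ G)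
  have c3 := Finset.card_union_le F G
  rw [Finset.card_univ] at c1
  omega

end main
end MTN

namespace MTN
section lists
variable {E : Type} {t : E → ℕ}

abbrev Srt (t : E → ℕ) (p : List E) : Prop := p.Pairwise (fun e f => t e < t f)

theorem Srt.inj {p : List E} (h : Srt t p) {e f : E} (he : e ∈ p) (hf : f ∈ p) (ht : t e = t f) :
    e = f := by
  by_contra hne
  induction p with
  | nil => simp at he
  | cons x p ih =>
    have h' := List.pairwise_cons.1 h
    rcases List.mem_cons.1 he with he' | he' <;> rcases List.mem_cons.1 hf with hf' | hf'
    · exact hne (he'.trans hf'.symm)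
    · have := h'.1 f hf'; subst he'; omega
    · have := h'.1 e he'; subst hf'; omega
    · exact ih h'.2 he' hf'

theorem Srt.pair {p : List E} (h : Srt t p) {f e : E} (hi : [f, e] <:+: p) :
    f ∈ p ∧ e ∈ p ∧ t f < t e ∧ ∀ g ∈ p, g = f ∨ g = e ∨ t g < t f ∨ t e < t g := by
  obtain ⟨l, r, rfl⟩ := hi
  simp only [Srt, List.append_assoc, List.pairwise_append, List.pairwise_cons, List.mem_append,
    List.mem_cons, List.cons_append, List.nil_append] at h
  refine ⟨by simp, by simp, h.2.1.1 e (by simp), ?_⟩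
  intro g hg
  simp only [List.append_assoc, List.mem_append, List.mem_cons, List.cons_append,
    List.nil_append] at hg
  rcases hg with hg | rfl | rfl | hg
  · exact Or.inr (Or.inr (Or.inl (h.2.2 g hg f (by simp))))
  · simp
  · simp
  · exact Or.inr (Or.inr (Or.inr (h.2.1.2.1 g hg)))

theorem Srt.pair_unique {p : List E} (h : Srt t p) {f g e : E} (hi : [f, e] <:+: p)
    (hj : [g, e] <:+: p) : f = g := by
  have h1 := h.pair hi
  have h2 := h.pair hj
  have a1 := h1.2.2.2 g h2.1
  have a2 := h2.2.2.2 f h1.1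
  have b1 := h1.2.2.1
  have b2 := h2.2.2.1
  apply h.inj h1.1 h2.1
  rcases a1 with rfl | rfl | a1 | a1
  · rfl
  · omega
  · rcases a2 with rfl | rfl | a2 | a2 <;> omega
  · omega

theorem exists_pair {x g : E} {l : List E} (hg : g ∈ l) : ∃ h, [h, g] <:+: x :: l := by
  induction l generalizing x with
  | nil => simp at hg
  | cons y l ih =>
    rcases List.mem_cons.1 hg with rfl | hg
    · exact ⟨x, ⟨[], l, by simp⟩⟩
    · obtain ⟨h, hh⟩ := ih (x := y) hg
      exact ⟨h, hh.trans (List.infix_cons (List.infix_refl _))⟩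

theorem Srt.split {l r : List E} {d g : E} (h : Srt t (l ++ d :: r)) :
    (g ∈ l → t g < t d) ∧ (g ∈ r → t d < t g) := by
  simp only [Srt, List.pairwise_append, List.pairwise_cons, List.mem_cons] at h
  exact ⟨fun hg => h.2.2 g hg d (by simp), fun hg => h.2.1.1 g hg⟩

end lists

section graph
variable {G : MultiDigraph} {t : G.E → ℕ}

theorem path_srt (ht : ∀ e f, G.dst e = G.src f → t e < t f) {u v : G.V} {p : List G.E}
    (h : G.IsPathFrom u v p) : Srt t p := by
  have h2 : List.IsChain (fun e f => G.dst e = G.src f) p := h.2.1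
  have h3 : List.IsChain (fun e f => t e < t f) p := h2.imp (fun e f hh => ht e f hh)
  haveI : Trans (fun e f : G.E => t e < t f) (fun e f : G.E => t e < t f)
    (fun e f : G.E => t e < t f) := ⟨fun h h' => lt_trans h h'⟩
  exact h3.pairwise

theorem splice (ht : ∀ e f, G.dst e = G.src f → t e < t f) {u v u' v' : G.V}
    {p q r : List G.E} (hp : G.IsPathFrom u v p) (hq : G.IsPathFrom u v q)
    (hr : G.IsPathFrom u' v' r) {d f : G.E} (dp : d ∈ p) (dr : d ∈ r) (fr : f ∈ r) (fq : f ∈ q)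
    (hdf : t d < t f) :
    ∃ L, G.IsPathFrom u v L ∧ (∃ h, [h, f] <:+: L ∧ [h, f] <:+: r) ∧
      ∀ g ∈ L, (g ∈ p ∧ t g ≤ t d ∧ ∀ h, [h, g] <:+: p → [h, g] <:+: L) ∨
        (g ∈ r ∧ t d < t g ∧ t g < t f ∧ ∃ h, [h, g] <:+: L ∧ [h, g] <:+: r) ∨
        (g ∈ q ∧ t f ≤ t g ∧ ∃ h, [h, g] <:+: L ∧ ([h, g] <:+: q ∨ [h, g] <:+: r)) := by
  have sp := path_srt ht hp
  have sq := path_srt ht hq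
  have sr := path_srt ht hr
  obtain ⟨l1, l2, rfl⟩ := List.append_of_mem dp
  obtain ⟨m1, m', rfl⟩ := List.append_of_mem dr
  obtain ⟨n1, n2, rfl⟩ := List.append_of_mem fq
  have fm : f ∈ m' := by
    have := (sr.split (g := f)).1
    simp only [List.mem_append, List.mem_cons] at fr
    rcases fr with h | rfl | h
    · have := this h; omega
    · omega
    · exact h
  obtain ⟨m2, m3, rfl⟩ := List.append_of_mem fm
  have cp : List.IsChain (fun e f => G.dst e = G.src f) (l1 ++ d :: l2) := hp.2.1
  have cq : List.IsChain (fun e f => G.dst e = G.src f) (n1 ++ f :: n2) := hq.2.1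
  have cr : List.IsChain (fun e f => G.dst e = G.src f) (m1 ++ d :: (m2 ++ f :: m3)) := hr.2.1
  have cr2 : List.IsChain (fun e f => G.dst e = G.src f) ((d :: m2) ++ f :: m3) :=
    (List.isChain_split.1 cr).2
  have midL : d :: (m2 ++ [f]) <:+: l1 ++ d :: (m2 ++ f :: n2) := ⟨l1, n2, by simp⟩
  have midR : d :: (m2 ++ [f]) <:+: m1 ++ d :: (m2 ++ f :: m3) := ⟨m1, m3, by simp⟩
  have mid : ∀ g ∈ m2 ++ [f], ∃ h, [h, g] <:+: l1 ++ d :: (m2 ++ f :: n2) ∧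
      [h, g] <:+: m1 ++ d :: (m2 ++ f :: m3) := by
    intro g hg
    obtain ⟨h, hh⟩ := exists_pair (x := d) hg
    exact ⟨h, hh.trans midL, hh.trans midR⟩
  refine ⟨l1 ++ d :: (m2 ++ f :: n2), ⟨by simp, ?_, ?_, ?_⟩, mid f (by simp), ?_⟩
  · refine List.isChain_split.2 ⟨(List.isChain_split.1 cp).1, ?_⟩
    exact List.isChain_split (l₁ := d :: m2).2
      ⟨(List.isChain_split.1 cr2).1, (List.isChain_split.1 cq).2⟩
  · have := hp.2.2.1
    cases l1 with
    | nil => simpa using this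
    | cons x l => simpa using this
  · have h := hq.2.2.2
    intro e he
    apply h e
    have e1 : l1 ++ d :: (m2 ++ f :: n2) = (l1 ++ d :: m2) ++ f :: n2 := by simp
    rw [e1, List.getLast?_append_cons] at he
    rw [List.getLast?_append_cons]
    exact he
  · intro g hg
    have hg' : g ∈ l1 ++ [d] ∨ g ∈ m2 ∨ g = f ∨ g ∈ n2 := by
      simp only [List.mem_append, List.mem_cons, List.not_mem_nil, or_false] at hg ⊢
      tauto
    rcases hg' with hg | hg | rfl | hg
    · left
      have hmem : g ∈ l1 ++ d :: l2 := by
        simp only [List.mem_append, List.mem_cons, List.not_mem_nil, or_false] at hg ⊢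
        tauto
      refine ⟨hmem, ?_, ?_⟩
      · simp only [List.mem_append, List.mem_cons, List.not_mem_nil, or_false] at hg
        rcases hg with hg | rfl
        · exact ((sp.split (g := g)).1 hg).le
        · exact le_rfl
      · intro h hh
        have i1 : l1 ++ [d] <:+: l1 ++ d :: (m2 ++ f :: n2) := ⟨[], m2 ++ f :: n2, by simp⟩
        have i2 : l1 ++ [d] <:+: l1 ++ d :: l2 := ⟨[], l2, by simp⟩
        cases hX : l1 ++ [d] with
        | nil => simp at hX
        | cons x X =>
          rw [hX] at hg i1 i2
          rcases List.mem_cons.1 hg with rfl | hg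
          · exfalso
            have h1 := sp.pair hh
            have e2 : l1 ++ d :: l2 = g :: (X ++ l2) := by
              have : l1 ++ d :: l2 = (l1 ++ [d]) ++ l2 := by simp
              rw [this, hX]; simp
            rw [e2] at h1 sp
            have s := List.pairwise_cons.1 sp
            rcases List.mem_cons.1 h1.1 with rfl | h2
            · have := h1.2.2.1; omega
            · have := s.1 h h2
              have := h1.2.2.1; omega
          · obtain ⟨h', hh'⟩ := exists_pair (x := x) hg
            have : h = h' := sp.pair_unique hh (hh'.trans i2)
            subst this
            exact hh'.trans i1
    · right; left
      refine ⟨by simp [hg], ?_, ?_, mid g (by simp [hg])⟩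
      · exact (sr.split (g := g)).2 (by simp [hg])
      · have e1 : m1 ++ d :: (m2 ++ f :: m3) = (m1 ++ d :: m2) ++ f :: m3 := by simp
        rw [e1] at sr
        exact (sr.split (g := g)).1 (by simp [hg])
    · right; right
      obtain ⟨h, h1, h2⟩ := mid g (by simp)
      exact ⟨by simp, le_rfl, h, h1, Or.inr h2⟩
    · right; right
      obtain ⟨h, hh⟩ := exists_pair (x := f) hg
      refine ⟨by simp [hg], ((sq.split (g := g)).2 hg).le, h, ?_, Or.inl ?_⟩
      · exact hh.trans ⟨l1 ++ d :: m2, [], by simp⟩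
      · exact hh.trans ⟨n1, [], by simp⟩

/-- starting edge of a shared subpath -/
def Pnt {c c' : ℕ} (A : Fin c → List G.E) (B : Fin c' → List G.E) (e : G.E) : Prop :=
  (∃ i, e ∈ A i) ∧ (∃ k, e ∈ B k) ∧ ¬ ∃ f i k, [f, e] <:+: A i ∧ [f, e] <:+: B k

theorem Pnt.symm {c c' : ℕ} {A : Fin c → List G.E} {B : Fin c' → List G.E} {e : G.E}
    (h : Pnt A B e) : Pnt B A e :=
  ⟨h.2.1, h.1, fun ⟨f, i, k, h1, h2⟩ => h.2.2 ⟨f, k, i, h2, h1⟩⟩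

theorem menger_idx {c : ℕ} {u v : G.V} {A : Fin c → List G.E} (hA : G.MengerSystem u v c A)
    {e : G.E} {i j : Fin c} (hi : e ∈ A i) (hj : e ∈ A j) : i = j := by
  by_contra h
  exact hA.2 i j h e hi hj

theorem mid_lemma (ht : ∀ e f, G.dst e = G.src f → t e < t f) {c c' : ℕ} {u v u' v' : G.V}
    {A : Fin c → List G.E} {B : Fin c' → List G.E} (hA : G.MengerSystem u v c A)
    (hB : G.MengerSystem u' v' c' B) {d f : G.E} {i : Fin c} {k : Fin c'} (di : d ∈ A i)
    (dk : d ∈ B k) (hno : ∀ g ∈ B k, Pnt A B g → t g ≤ t d ∨ t f ≤ t g) :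
    ∀ (N : ℕ) (g : G.E), t g ≤ N → g ∈ B k → t d < t g → t g < t f → ∀ i', g ∈ A i' → i' = i ∧
      ∀ f' ∈ A i, Pnt A B f' → t d < t f' → t g < t f' := by
  intro N
  induction N with
  | zero => intro g hN _ h; omega
  | succ N ih =>
    intro g hN gk l1 l2 i' gi
    have np : ¬ Pnt A B g := fun hp => by have := hno g gk hp; omega
    have : ∃ f i k, [f, g] <:+: A i ∧ [f, g] <:+: B k := by
      by_contra hcon
      exact np ⟨⟨i', gi⟩, ⟨k, gk⟩, hcon⟩
    obtain ⟨h, i2, k2, hi, hk⟩ := this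
    have pi := (path_srt ht (hA.1 i2)).pair hi
    have pk := (path_srt ht (hB.1 k2)).pair hk
    obtain rfl := menger_idx hA pi.2.1 gi
    obtain rfl := menger_idx hB pk.2.1 gk
    have hlt := pi.2.2.1
    have fin : i2 = i ∧ ∀ f' ∈ A i, Pnt A B f' → t d < t f' → t h < t f' ∨ h = d := by
      rcases pk.2.2.2 d dk with rfl | rfl | hh | hh
      · exact ⟨menger_idx hA pi.1 di, fun _ _ _ _ => Or.inr rfl⟩
      · omega
      · have := ih h (by omega) pk.1 hh (by omega) i2 pi.1
        exact ⟨this.1, fun f' q1 q2 q3 => Or.inl (this.2 f' q1 q2 q3)⟩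
      · omega
    refine ⟨fin.1, fun f' q1 q2 q3 => ?_⟩
    obtain ⟨rfl, fin⟩ := fin
    have h1 : t h < t f' := by
      rcases fin f' q1 q2 q3 with h | rfl
      · exact h
      · exact q3
    rcases pi.2.2.2 f' q1 with rfl | rfl | hh | hh
    · omega
    · exact absurd q2 np
    · omega
    · exact hh

theorem reroute (ht : ∀ e f, G.dst e = G.src f → t e < t f) {c c' : ℕ} {u v u' v' : G.V}
    {A : Fin c → List G.E} {B : Fin c' → List G.E} (hA : G.MengerSystem u v c A)
    (hB : G.MengerSystem u' v' c' B) (a : {e // Pnt A B e} → Fin c) (b : {e // Pnt A B e} → Fin c')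
    (ha : ∀ e, e.1 ∈ A (a e)) (hb : ∀ e, e.1 ∈ B (b e))
    (hmin : ∀ A', G.MengerSystem u v c A' → ¬ {e | Pnt A' B e} ⊂ {e | Pnt A B e}) :
    NoRR (fun e : {e // Pnt A B e} => t e.1) a b := by
  intro K s π hne iK hs hπ iπ
  have hsp : ∀ i, ∃ L, ((∃ d ∈ K, a d = i ∧ G.IsPathFrom u v L ∧
      (∃ h, [h, (s d).1] <:+: L ∧ [h, (s d).1] <:+: B (b d)) ∧
      ∀ g ∈ L, (g ∈ A i ∧ t g ≤ t d ∧ ∀ h, [h, g] <:+: A i → [h, g] <:+: L) ∨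
        (g ∈ B (b d) ∧ t d < t g ∧ t g < t (s d).1 ∧
          ∃ h, [h, g] <:+: L ∧ [h, g] <:+: B (b d)) ∨
        (g ∈ A (a (s d)) ∧ t (s d).1 ≤ t g ∧
          ∃ h, [h, g] <:+: L ∧ ([h, g] <:+: A (a (s d)) ∨ [h, g] <:+: B (b d)))) ∨
      ((∀ d ∈ K, a d ≠ i) ∧ L = A i)) := by
    intro i
    by_cases h : ∃ d ∈ K, a d = i
    · obtain ⟨d, hd, rfl⟩ := h
      obtain ⟨L, h1, h2, h3⟩ := splice ht (hA.1 (a d)) (hA.1 (a (s d))) (hB.1 (b d)) (ha d) (hb d)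
        (by have := hb (s d); rwa [← (hs d hd).1] at this) (ha (s d)) (hs d hd).2.1
      exact ⟨L, Or.inl ⟨d, hd, rfl, h1, h2, h3⟩⟩
    · exact ⟨A i, Or.inr ⟨fun d hd hh => h ⟨d, hd, hh⟩, rfl⟩⟩
  choose A' hA' using hsp
  have cls : ∀ i, ∀ g ∈ A' i, (g ∈ A i ∧ ∀ d ∈ K, a d = i → t g ≤ t d) ∨
      (∃ d ∈ K, a d = i ∧ g ∈ B (b d) ∧ t d < t g ∧ t g < t (s d).1) ∨
      (∃ d ∈ K, a d = i ∧ g ∈ A (a (s d)) ∧ t (s d).1 ≤ t g) := by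
    intro i g hg
    rcases hA' i with ⟨d, hd, hi, -, -, h3⟩ | ⟨hno, heq⟩
    · rcases h3 g hg with ⟨h4, h5, -⟩ | ⟨h4, h5, h6, -⟩ | ⟨h4, h5, -⟩
      · left
        refine ⟨h4, fun d' hd' hi' => ?_⟩
        have : d' = d := iK hd' hd (hi'.trans hi.symm)
        subst this; exact h5
      · exact Or.inr (Or.inl ⟨d, hd, hi, h4, h5, h6⟩)
      · exact Or.inr (Or.inr ⟨d, hd, hi, h4, h5⟩)
    · left
      rw [heq] at hg
      exact ⟨hg, fun d hd hi => absurd hi (hno d hd)⟩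
  have midl : ∀ d ∈ K, ∀ g, g ∈ B (b d) → t d < t g → t g < t (s d).1 → ∀ i', g ∈ A i' →
      i' = a d ∧ ∀ f' ∈ A (a d), Pnt A B f' → t d < t f' → t g < t f' := by
    intro d hd g h1 h2 h3 i' h4
    refine mid_lemma ht hA hB (f := (s d).1) (ha d) (hb d) ?_ (t g) g le_rfl h1 h2 h3 i' h4
    intro g gk hp
    exact (hs d hd).2.2 ⟨g, hp⟩ (menger_idx hB (hb ⟨g, hp⟩) gk)
  have HM : ∀ i j g, i ≠ j → g ∈ A i →
      (∃ d ∈ K, a d = j ∧ g ∈ B (b d) ∧ t d < t g ∧ t g < t (s d).1) → False := by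
    rintro i j g hij gi ⟨d, hd, rfl, h1, h2, h3⟩
    exact hij (midl d hd g h1 h2 h3 i gi).1
  have HT : ∀ i j g, (g ∈ A i ∧ ∀ d ∈ K, a d = i → t g ≤ t d) →
      (∃ d ∈ K, a d = j ∧ g ∈ A (a (s d)) ∧ t (s d).1 ≤ t g) → False := by
    rintro i j g ⟨gi, hg⟩ ⟨d, hd, rfl, h1, h2⟩
    obtain rfl := menger_idx hA gi h1
    obtain ⟨q1, q2, q3⟩ := hπ d hd
    have := hg (π d) q1 q2
    simp only at q3
    omega
  have MT : ∀ i j g, i ≠ j → (∃ d ∈ K, a d = i ∧ g ∈ B (b d) ∧ t d < t g ∧ t g < t (s d).1) →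
      (∃ d ∈ K, a d = j ∧ g ∈ A (a (s d)) ∧ t (s d).1 ≤ t g) → False := by
    rintro i j g hij ⟨d, hd, rfl, h1, h2, h3⟩ ⟨d', hd', rfl, h1', h2'⟩
    obtain ⟨e1, e2⟩ := midl d hd g h1 h2 h3 _ h1'
    obtain ⟨q1, q2, q3⟩ := hπ d' hd'
    have : π d' = d := iK q1 hd (q2.trans e1)
    have := e2 (s d').1 (e1 ▸ ha (s d')) (s d').2 (by rw [← this]; exact q3)
    omega
  have hM' : G.MengerSystem u v c A' := by
    refine ⟨fun i => ?_, fun i j hij g gi gj => ?_⟩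
    · rcases hA' i with ⟨d, hd, hi, h, -⟩ | ⟨-, heq⟩
      · exact h
      · rw [heq]; exact hA.1 i
    · rcases cls i g gi with hi | hi | hi <;> rcases cls j g gj with hj | hj | hj
      · exact hij (menger_idx hA hi.1 hj.1)
      · exact HM i j g hij hi.1 hj
      · exact HT i j g hi hj
      · exact HM j i g hij.symm hj.1 hi
      · obtain ⟨d, hd, rfl, h1, h2, h3⟩ := hi
        obtain ⟨d', hd', rfl, h1', h2', h3'⟩ := hj
        have hk := menger_idx hB h1 h1'
        have r1 := (hs d hd).2.2 d' hk.symm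
        have r2 := (hs d' hd').2.2 d hk
        have r3 := (hs d hd).2.2 (s d') (by rw [← (hs d' hd').1]; exact hk.symm)
        have r4 := (hs d' hd').2.2 (s d) (by rw [← (hs d hd).1]; exact hk)
        simp only at r1 r2 r3 r4
        have : t d.1 = t d'.1 := by omega
        have e := (path_srt ht (hB.1 (b d))).inj (hb d) (hk ▸ hb d') this
        exact hij (congrArg a (Subtype.ext e))
      · exact MT i j g hij hi hj
      · exact HT j i g hj hi
      · exact MT j i g hij.symm hj hi
      · obtain ⟨d, hd, rfl, h1, h2⟩ := hi
        obtain ⟨d', hd', rfl, h1', h2'⟩ := hj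
        have hk := menger_idx hA h1 h1'
        have : π d = π d' := iK (hπ d hd).1 (hπ d' hd').1 (by
          rw [(hπ d hd).2.1, (hπ d' hd').2.1]; exact hk)
        exact hij (congrArg a (iπ hd hd' this))
  refine hmin A' hM' ⟨?_, ?_⟩
  · rintro g ⟨⟨i, gi⟩, ⟨k, gk⟩, hno⟩
    show Pnt A B g
    rcases hA' i with ⟨d, hd, hi, -, -, h3⟩ | ⟨-, heq⟩
    · rcases h3 g gi with ⟨h4, h5, h6⟩ | ⟨h4, h5, h6, h, h7, h8⟩ | ⟨h4, h5, h, h7, h8⟩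
      · refine ⟨⟨i, h4⟩, ⟨k, gk⟩, ?_⟩
        rintro ⟨f, i', k', q1, q2⟩
        have := menger_idx hA ((path_srt ht (hA.1 i')).pair q1).2.1 h4
        subst this
        exact hno ⟨f, i', k', h6 f q1, q2⟩
      · exact absurd ⟨h, i, b d, h7, h8⟩ hno
      · rcases h8 with h8 | h8
        · refine ⟨⟨_, h4⟩, ⟨k, gk⟩, ?_⟩
          rintro ⟨f, i', k', q1, q2⟩
          have := menger_idx hA ((path_srt ht (hA.1 i')).pair q1).2.1 h4
          subst this
          have := (path_srt ht (hA.1 _)).pair_unique q1 h8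
          subst this
          exact hno ⟨f, i, k', h7, q2⟩
        · exact absurd ⟨h, i, b d, h7, h8⟩ hno
    · rw [heq] at gi
      refine ⟨⟨i, gi⟩, ⟨k, gk⟩, ?_⟩
      rintro ⟨f, i', k', q1, q2⟩
      have := menger_idx hA ((path_srt ht (hA.1 i')).pair q1).2.1 gi
      subst this
      exact hno ⟨f, i', k', heq ▸ q1, q2⟩
  · intro hsub
    obtain ⟨d, hd⟩ := hne
    have hp : Pnt A' B (s d).1 := hsub (s d).2
    rcases hA' (a d) with ⟨d', hd', hi, -, ⟨h, h1, h2⟩, -⟩ | ⟨hno, -⟩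
    · have : d' = d := iK hd' hd hi
      subst this
      exact hp.2.2 ⟨h, _, _, h1, h2⟩
    · exact hno d hd rfl

theorem exists_rank (hG : G.Acyclic) : ∃ t : G.E → ℕ, ∀ e f, G.dst e = G.src f → t e < t f := by
  classical
  haveI := G.fintE
  let R : G.E → G.E → Prop := fun e f => G.dst e = G.src f
  have key : ∀ e f, Relation.TransGen R e f → ∃ p, G.IsPathFrom (G.src e) (G.src f) p := by
    intro e f h
    induction h with
    | single h => exact ⟨[e], by simp, List.isChain_singleton _, by simp, by simpa using h⟩
    | @tail x y _ h ih =>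
      obtain ⟨p, h1, h2, h3, h4⟩ := ih
      refine ⟨p ++ [x], by simp, ?_, ?_, ?_⟩
      · refine List.isChain_append.2 ⟨h2, List.isChain_singleton _, ?_⟩
        intro a ha b hb
        simp at hb
        subst hb
        exact h4 a ha
      · intro a ha
        cases p with
        | nil => exact absurd rfl h1
        | cons z p => exact h3 a (by simpa using ha)
      · intro a ha
        simp at ha
        subst ha; exact h
  refine ⟨fun e => (Finset.univ.filter (fun g => Relation.TransGen R g e)).card, ?_⟩
  intro e f hef
  apply Finset.card_lt_card
  refine ⟨fun g hg => ?_, fun hsub => ?_⟩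
  · simp only [Finset.mem_filter, Finset.mem_univ, true_and] at hg ⊢
    exact hg.tail hef
  · have : e ∈ Finset.univ.filter (fun g => Relation.TransGen R g f) := by
      simp only [Finset.mem_filter, Finset.mem_univ, true_and]
      exact Relation.TransGen.single hef
    have := hsub this
    simp only [Finset.mem_filter, Finset.mem_univ, true_and] at this
    obtain ⟨p, hp⟩ := key e e this
    exact hG _ p hp

theorem upper (n : ℕ) (hn : 0 < n) : MAtMost ![2, n] (3 * n - 1) := by
  classical
  intro G S R hG _
  haveI := G.fintE
  obtain ⟨hac, -, hmc⟩ := hG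
  obtain ⟨t, ht⟩ := exists_rank hac
  obtain ⟨A0, hA0⟩ : ∃ A : Fin 2 → List G.E, G.MengerSystem (S 0) (R 0) 2 A := (hmc 0).1
  obtain ⟨B0, hB0⟩ : ∃ B : Fin n → List G.E, G.MengerSystem (S 1) (R 1) n B := (hmc 1).1
  have hex : ∃ m : ℕ, ∃ (A : Fin 2 → List G.E) (B : Fin n → List G.E),
      G.MengerSystem (S 0) (R 0) 2 A ∧ G.MengerSystem (S 1) (R 1) n B ∧
      {e | Pnt A B e}.ncard = m := ⟨_, A0, B0, hA0, hB0, rfl⟩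
  obtain ⟨A, B, hA, hB, hm⟩ := Nat.find_spec hex
  have hmin := fun m => Nat.find_min' hex (m := m)
  rw [← hm] at hmin
  have ha : ∀ e : {e // Pnt A B e}, ∃ i, e.1 ∈ A i := fun e => e.2.1
  have hb : ∀ e : {e // Pnt A B e}, ∃ i, e.1 ∈ B i := fun e => e.2.2.1
  choose a ha using ha
  choose b hb using hb
  have h1 : NoRR (fun e : {e // Pnt A B e} => t e.1) a b := by
    refine reroute ht hA hB a b ha hb fun A' hA' hss => ?_
    have := hmin _ ⟨A', B, hA', hB, rfl⟩
    have := Set.ncard_lt_ncard hss (Set.toFinite _)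
    omega
  have hsym : ∀ (A : Fin 2 → List G.E) (B : Fin n → List G.E) e, Pnt B A e ↔ Pnt A B e :=
    fun A B e => ⟨Pnt.symm, Pnt.symm⟩
  have h2 : NoRR (fun e : {e // Pnt A B e} => t e.1) b a := by
    have := reroute ht hB hA (fun e => b ⟨e.1, e.2.symm⟩) (fun e => a ⟨e.1, e.2.symm⟩)
      (fun e => hb ⟨e.1, e.2.symm⟩) (fun e => ha ⟨e.1, e.2.symm⟩) (by
        intro B' hB' hss
        have h3 := hmin _ ⟨A, B', hA, hB', rfl⟩
        have h4 := Set.ncard_lt_ncard hss (Set.toFinite _)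
        simp only [hsym] at h4
        omega)
    have hfun : (fun e => Pnt B A e) = (fun e => Pnt A B e) := by
      funext e; exact propext (hsym A B e)
    intro K s π q1 q2 q3 q4 q5
    let φ : {e // Pnt A B e} ≃ {e // Pnt B A e} :=
      Equiv.subtypeEquivRight (fun e => (hsym A B e).symm)
    refine this (K.map φ.toEmbedding) (fun e => φ (s (φ.symm e))) (fun e => φ (π (φ.symm e)))
      (by simpa using q1) ?_ ?_ ?_ ?_
    · intro x hx y hy hxy
      simp only [Finset.coe_map, Set.mem_image, Finset.mem_coe] at hx hy
      obtain ⟨x, hx, rfl⟩ := hx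
      obtain ⟨y, hy, rfl⟩ := hy
      exact congrArg φ (q2 hx hy hxy)
    · intro x0 hx0
      obtain ⟨x, hx, rfl⟩ := Finset.mem_map.1 hx0
      have := q3 x hx
      refine ⟨?_, ?_, ?_⟩
      · exact this.1
      · exact this.2.1
      · intro g hg
        exact this.2.2 (φ.symm g) hg
    · intro x0 hx0
      obtain ⟨x, hx, rfl⟩ := Finset.mem_map.1 hx0
      have := q4 x hx
      refine ⟨?_, ?_, ?_⟩
      · exact Finset.mem_map_of_mem _ this.1
      · exact this.2.1
      · exact this.2.2
    · intro x hx y hy hxy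
      simp only [Finset.coe_map, Set.mem_image, Finset.mem_coe] at hx hy
      obtain ⟨x, hx, rfl⟩ := hx
      obtain ⟨y, hy, rfl⟩ := hy
      refine congrArg φ (q5 hx hy ?_)
      simpa using hxy
  have hc := count (Pt := {e // Pnt A B e}) (t := fun e => t e.1) (a := a) (b := b)
    (fun e f he hte => Subtype.ext ((path_srt ht (hB.1 (b e))).inj (hb e) (he ▸ hb f) hte))
    (fun e f he hte => Subtype.ext ((path_srt ht (hA.1 (a e))).inj (ha e) (he ▸ ha f) hte))
    hn h1 h2
  let α : (i : Fin 2) → Fin (![2, n] i) → List G.E :=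
    Fin.cases A (Fin.cases B (fun i => i.elim0))
  have hα : ∀ i, G.MengerSystem (S i) (R i) (![2, n] i) (α i) := by
    intro i
    fin_cases i
    · exact hA
    · exact hB
  refine ⟨α, hα, ?_⟩
  have hsub : {e | G.MergingEdge α e} ⊆ {e | Pnt A B e} := by
    have key : ∀ e (i : Fin 2) (k : Fin n) f g, f ≠ g → [f, e] <:+: A i → [g, e] <:+: B k →
        Pnt A B e := by
      intro e i k f g hfg h1 h2
      refine ⟨⟨i, ((path_srt ht (hA.1 i)).pair h1).2.1⟩,
        ⟨k, ((path_srt ht (hB.1 k)).pair h2).2.1⟩, ?_⟩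
      rintro ⟨h, i', k', q1, q2⟩
      obtain rfl := menger_idx hA ((path_srt ht (hA.1 i)).pair h1).2.1
        ((path_srt ht (hA.1 i')).pair q1).2.1
      obtain rfl := menger_idx hB ((path_srt ht (hB.1 k)).pair h2).2.1
        ((path_srt ht (hB.1 k')).pair q2).2.1
      exact hfg (((path_srt ht (hA.1 i)).pair_unique h1 q1).trans
        ((path_srt ht (hB.1 k)).pair_unique q2 h2))
    rintro e ⟨i, j, hij, x, y, f, g, hfg, h1, h2⟩
    fin_cases i <;> fin_cases j
    · exact absurd rfl hij
    · exact key e x y f g hfg h1 h2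
    · exact key e y x g f hfg.symm h2 h1
    · exact absurd rfl hij
  have := Set.ncard_le_ncard hsub (Set.toFinite _)
  rw [Set.ncard_eq_toFinset_card'] at this
  unfold MultiDigraph.mergingCount
  refine le_trans (Set.ncard_le_ncard hsub (Set.toFinite _)) ?_
  rw [← Nat.card_coe_set_eq, Nat.card_eq_fintype_card]
  exact hc

end graph
end MTN

namespace MTN
section pot
variable {G : MultiDigraph}

theorem path_snoc {u v w : G.V} {p : List G.E} {e : G.E} (hp : G.IsPathFrom u v p)
    (h1 : G.src e = v) (h2 : G.dst e = w) : G.IsPathFrom u w (p ++ [e]) := by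
  obtain ⟨hne, hc, hh, hl⟩ := hp
  refine ⟨by simp, ?_, ?_, ?_⟩
  · refine List.isChain_append.2 ⟨hc, List.isChain_singleton _, ?_⟩
    intro x hx y hy
    simp at hy
    subst hy
    rw [hl x hx, h1]
  · cases p with
    | nil => exact absurd rfl hne
    | cons a p => simpa using hh
  · simp [h2]

theorem path_single {v w : G.V} {e : G.E}
    (h1 : G.src e = v) (h2 : G.dst e = w) : G.IsPathFrom v w [e] := by
  refine ⟨by simp, List.isChain_singleton _, ?_, ?_⟩ <;> simp [h1, h2]

theorem path_cons_cons {u v : G.V} {a b : G.E} {p : List G.E}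
    (h : G.IsPathFrom u v (a :: b :: p)) :
    G.src a = u ∧ G.dst a = G.src b ∧ G.IsPathFrom (G.src b) v (b :: p) := by
  obtain ⟨hne, hc, hh, hl⟩ := h
  have hc' := List.isChain_cons_cons.1 hc
  refine ⟨by simpa using hh, hc'.1, by simp, hc'.2, by simp, ?_⟩
  simpa using hl

theorem path_cross (P : G.V → ℕ) (θ : ℕ) {v : G.V} (p : List G.E) :
    ∀ u, G.IsPathFrom u v p → P u ≤ θ → θ < P v →
    ∃ e ∈ p, P (G.src e) ≤ θ ∧ θ < P (G.dst e) := by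
  induction p with
  | nil => intro u h; exact absurd rfl h.1
  | cons a p ih =>
    intro u h hu hv
    have ha : G.src a = u := h.2.2.1 a (by simp)
    by_cases hd : θ < P (G.dst a)
    · exact ⟨a, by simp, by rw [ha]; exact hu, hd⟩
    · cases p with
      | nil =>
        have hb : G.dst a = v := h.2.2.2 a (by simp)
        rw [hb] at hd
        exact absurd hv hd
      | cons b p =>
        have h' := path_cons_cons h
        obtain ⟨e, he, h2⟩ := ih _ h'.2.2 (by rw [← h'.2.1]; omega) hv
        exact ⟨e, List.mem_cons_of_mem _ he, h2⟩

theorem path_mono (P : G.V → ℕ) (hP : ∀ e, P (G.src e) < P (G.dst e)) {v : G.V} (p : List G.E) :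
    ∀ u, G.IsPathFrom u v p → P u < P v := by
  induction p with
  | nil => intro u h; exact absurd rfl h.1
  | cons a p ih =>
    intro u h
    have ha : G.src a = u := h.2.2.1 a (by simp)
    have := hP a
    rw [ha] at this
    cases p with
    | nil =>
      have hb : G.dst a = v := h.2.2.2 a (by simp)
      rwa [hb] at this
    | cons b p =>
      have h' := path_cons_cons h
      have := ih _ h'.2.2
      rw [← h'.2.1] at this
      omega

theorem path_next {u v : G.V} {p : List G.E} (h : G.IsPathFrom u v p) {e m : G.E} (he : e ∈ p)
    (hv : G.dst e ≠ v) (hm : ∀ f, G.src f = G.dst e → f = m) : [e, m] <:+: p := by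
  obtain ⟨l1, l2, rfl⟩ := List.append_of_mem he
  cases l2 with
  | nil => exact absurd (h.2.2.2 e (by simp)) hv
  | cons f l3 =>
    have hc := (List.isChain_append.1 h.2.1).2.1
    have := hm f (List.isChain_cons_cons.1 hc).1.symm
    subst this
    exact ⟨l1, l3, by simp⟩

variable {c : ℕ} (P : G.V → ℕ) (OL : G.E → Fin c → Prop) {s d : G.V}

theorem no_more (hs : P s = 0) (hd : 0 < P d)
    (hA : ∀ e θ, P (G.src e) ≤ θ → θ < P (G.dst e) → ∃ j, OL e j)
    (hB : ∀ e e' j θ, OL e j → OL e' j → P (G.src e) ≤ θ → θ < P (G.dst e) →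
      P (G.src e') ≤ θ → θ < P (G.dst e') → e = e') :
    ¬∃ α : Fin (c + 1) → List G.E, G.MengerSystem s d (c + 1) α := by
  rintro ⟨α, hα, hdis⟩
  have h1 := fun i => path_cross P 0 (α i) s (hα i) (by omega) hd
  choose e he h2 h3 using h1
  choose j hj using fun i => hA (e i) 0 (h2 i) (h3 i)
  obtain ⟨x, y, hxy, hjj⟩ := Fintype.exists_ne_map_eq_of_card_lt j (by simp)
  have := hB (e x) (e y) (j x) 0 (hj x) (hjj ▸ hj y) (h2 x) (h3 x) (h2 y) (h3 y)
  exact hdis x y hxy (e x) (he x) (this ▸ he y)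

theorem all_used (hs : P s = 0)
    (hA : ∀ e θ, P (G.src e) ≤ θ → θ < P (G.dst e) → ∃ j, OL e j)
    (hB : ∀ e e' j θ, OL e j → OL e' j → P (G.src e) ≤ θ → θ < P (G.dst e) →
      P (G.src e') ≤ θ → θ < P (G.dst e') → e = e')
    {α : Fin c → List G.E} (hα : G.MengerSystem s d c α) {e : G.E} {k : Fin c} (hk : OL e k)
    (hlt : P (G.src e) < P (G.dst e)) (hd : P (G.src e) < P d) : ∃ i, e ∈ α i := by
  obtain ⟨hα, hdis⟩ := hα
  have h1 := fun i => path_cross P (P (G.src e)) (α i) s (hα i) (by omega) hd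
  choose f he h2 h3 using h1
  choose j hj using fun i => hA (f i) _ (h2 i) (h3 i)
  have hinj : Function.Injective j := by
    intro x y hjj
    by_contra hxy
    have := hB (f x) (f y) (j x) _ (hj x) (hjj ▸ hj y) (h2 x) (h3 x) (h2 y) (h3 y)
    exact hdis x y hxy (f x) (he x) (this ▸ he y)
  obtain ⟨i, hi⟩ := (Finite.injective_iff_surjective.1 hinj) k
  have := hB e (f i) k _ hk (hi ▸ hj i) le_rfl hlt (h2 i) (h3 i)
  exact ⟨i, this ▸ he i⟩

end pot

/-- The combinatorial data of the extremal graph. -/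
structure LData (Q : Type) (c : Fin 2 → ℕ) where
  pred : Fin 2 → Q → Option Q
  last : (g : Fin 2) → Fin (c g) → Q
  lab : (g : Fin 2) → Q → Fin (c g)
  r : Q → ℕ
  fi : Fin 2 → Q → ℕ
  fo : Fin 2 → Q → ℕ
  T : ℕ
  hr : ∀ g q p, pred g q = some p → r p < r q
  hT : ∀ q, r q < T
  hlab : ∀ g q p, pred g q = some p → lab g p = lab g q
  hlast : ∀ g j, lab g (last g j) = j
  hpos : ∀ g q, 0 < fi g q
  hio : ∀ g q, fi g q < fo g q
  hoT : ∀ g q, fo g q < T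
  hown : ∀ g q p, pred g q = some p → fo g p < fi g q
  hoth : ∀ g g' q p, g' ≠ g → pred g' q = some p → fi g q ≤ fo g p
  hdis : ∀ g q q', q ≠ q' → lab g q = lab g q' →
    fo g q ≤ (pred g q').elim 0 (fo g) ∨ fo g q' ≤ (pred g q).elim 0 (fo g)
  hmax : ∀ g q, fo g q ≤ fo g (last g (lab g q))

namespace LData
variable {Q : Type} [Fintype Q] {c : Fin 2 → ℕ} (D : LData Q c)

/-- The graph of the data. -/
def gr : MultiDigraph where
  V := (Fin 2 ⊕ Fin 2) ⊕ (Q ⊕ Q)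
  E := Q ⊕ ((Fin 2 × Q) ⊕ (Σ g, Fin (c g)))
  fintV := inferInstance
  fintE := inferInstance
  src := fun e => match e with
    | .inl q => .inr (.inl q)
    | .inr (.inl (g, q)) => (D.pred g q).elim (.inl (.inl g)) (fun p => .inr (.inr p))
    | .inr (.inr ⟨g, j⟩) => .inr (.inr (D.last g j))
  dst := fun e => match e with
    | .inl q => .inr (.inr q)
    | .inr (.inl (_, q)) => .inr (.inl q)
    | .inr (.inr ⟨g, _⟩) => .inl (.inr g)

/-- source vertex -/
def S (g : Fin 2) : D.gr.V := Sum.inl (.inl g)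
/-- sink vertex -/
def R (g : Fin 2) : D.gr.V := Sum.inl (.inr g)
/-- in vertex -/
def vi (q : Q) : D.gr.V := Sum.inr (.inl q)
/-- out vertex -/
def vo (q : Q) : D.gr.V := Sum.inr (.inr q)
/-- middle edge -/
def em (q : Q) : D.gr.E := Sum.inl q
/-- link edge -/
def el (g : Fin 2) (q : Q) : D.gr.E := Sum.inr (.inl (g, q))
/-- final edge -/
def ee (g : Fin 2) (j : Fin (c g)) : D.gr.E := Sum.inr (.inr ⟨g, j⟩)

/-- potential -/
def P (g : Fin 2) : D.gr.V → ℕ := fun v => match v with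
  | .inl (.inl g') => if g' = g then 0 else D.T
  | .inl (.inr g') => if g' = g then D.T else 0
  | .inr (.inl q) => D.fi g q
  | .inr (.inr q) => D.fo g q

/-- rank -/
def rk : D.gr.V → ℕ := fun v => match v with
  | .inl (.inl _) => 0
  | .inl (.inr _) => 2 * D.T + 3
  | .inr (.inl q) => 2 * D.r q + 1
  | .inr (.inr q) => 2 * D.r q + 2

/-- own edges with label -/
def OL (g : Fin 2) : D.gr.E → Fin (c g) → Prop := fun e j => match e with
  | .inl q => D.lab g q = j
  | .inr (.inl (g', q)) => g' = g ∧ D.lab g q = j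
  | .inr (.inr x) => x = ⟨g, j⟩

/-- lower end -/
def lo (g : Fin 2) (q : Q) : ℕ := (D.pred g q).elim 0 (D.fo g)

theorem lo_lt (g q) : D.lo g q < D.fi g q := by
  unfold lo
  cases h : D.pred g q with
  | none => exact D.hpos g q
  | some p => exact D.hown g q p h

theorem edge_cases {C : D.gr.E → Prop} (h1 : ∀ q, C (D.em q)) (h2 : ∀ g q, C (D.el g q))
    (h3 : ∀ g j, C (D.ee g j)) : ∀ e, C e := by
  rintro (q | ⟨g, q⟩ | ⟨g, j⟩)
  · exact h1 q
  · exact h2 g q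
  · exact h3 g j

@[simp] theorem P_em_src (g q) : D.P g (D.gr.src (D.em q)) = D.fi g q := rfl
@[simp] theorem P_em_dst (g q) : D.P g (D.gr.dst (D.em q)) = D.fo g q := rfl
@[simp] theorem P_el_dst (g g' q) : D.P g (D.gr.dst (D.el g' q)) = D.fi g q := rfl
@[simp] theorem P_ee_src (g g' j) : D.P g (D.gr.src (D.ee g' j)) = D.fo g (D.last g' j) := rfl
@[simp] theorem P_ee_dst (g g' j) : D.P g (D.gr.dst (D.ee g' j)) = if g' = g then D.T else 0 := rfl
theorem el_src (g q) : D.gr.src (D.el g q) = (D.pred g q).elim (D.S g) D.vo := rfl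
@[simp] theorem P_el_src (g q) : D.P g (D.gr.src (D.el g q)) = D.lo g q := by
  rw [el_src, lo]
  cases D.pred g q with
  | none => exact if_pos rfl
  | some p => rfl
theorem P_el_src_ne (g g' q) (h : g' ≠ g) : D.fi g q ≤ D.P g (D.gr.src (D.el g' q)) := by
  rw [el_src]
  cases hp : D.pred g' q with
  | none => exact ((D.hio g q).trans (D.hoT g q)).le.trans (if_neg h).ge
  | some p => exact D.hoth g g' q p h hp

@[simp] theorem OL_em (g q j) : D.OL g (D.em q) j ↔ D.lab g q = j := Iff.rfl
@[simp] theorem OL_el (g g' q j) : D.OL g (D.el g' q) j ↔ g' = g ∧ D.lab g q = j := Iff.rfl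
theorem OL_ee (g g' j' j) : D.OL g (D.ee g' j') j ↔ (⟨g', j'⟩ : Σ g, Fin (c g)) = ⟨g, j⟩ := Iff.rfl

theorem OL_unique (g e j j') (h : D.OL g e j) (h' : D.OL g e j') : j = j' := by
  revert h h'
  refine D.edge_cases (C := fun e => D.OL g e j → D.OL g e j' → j = j') ?_ ?_ ?_ e
  · intro q h h'; exact h.symm.trans h'
  · intro g' q h h'; exact h.2.symm.trans h'.2
  · intro g' k h h'
    have := h.symm.trans h'
    simpa using this

theorem hA (g e θ) (h1 : D.P g (D.gr.src e) ≤ θ) (h2 : θ < D.P g (D.gr.dst e)) :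
    ∃ j, D.OL g e j := by
  revert h1 h2
  refine D.edge_cases (C := fun e => D.P g (D.gr.src e) ≤ θ → θ < D.P g (D.gr.dst e) →
    ∃ j, D.OL g e j) ?_ ?_ ?_ e
  · intro q _ _; exact ⟨_, rfl⟩
  · intro g' q h1 h2
    by_cases h : g' = g
    · exact ⟨_, h, rfl⟩
    · have := D.P_el_src_ne g g' q h
      simp at h2
      omega
  · intro g' j h1 h2
    by_cases h : g' = g
    · subst h; exact ⟨j, rfl⟩
    · simp [h] at h2

/-- interval data of own edges -/
theorem OL_int (g e j) (h : D.OL g e j) :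
    (∃ q, D.lab g q = j ∧ e = D.em q) ∨ (∃ q, D.lab g q = j ∧ e = D.el g q) ∨ e = D.ee g j := by
  revert h
  refine D.edge_cases (C := fun e => D.OL g e j →
    (∃ q, D.lab g q = j ∧ e = D.em q) ∨ (∃ q, D.lab g q = j ∧ e = D.el g q) ∨ e = D.ee g j)
    ?_ ?_ ?_ e
  · intro q h; exact Or.inl ⟨q, h, rfl⟩
  · rintro g' q ⟨rfl, h⟩; exact Or.inr (Or.inl ⟨q, h, rfl⟩)
  · intro g' k h
    refine Or.inr (Or.inr ?_)
    exact congrArg (fun x => (Sum.inr (Sum.inr x) : D.gr.E)) h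

theorem hB (g) (e e' j θ) (h : D.OL g e j) (h' : D.OL g e' j)
    (h1 : D.P g (D.gr.src e) ≤ θ) (h2 : θ < D.P g (D.gr.dst e))
    (h3 : D.P g (D.gr.src e') ≤ θ) (h4 : θ < D.P g (D.gr.dst e')) : e = e' := by
  have hlo := D.lo_lt g
  have hio := D.hio g
  have hmax := D.hmax g
  have hd : ∀ q q', D.lab g q = j → D.lab g q' = j → q = q' ∨
      D.fo g q ≤ D.lo g q' ∨ D.fo g q' ≤ D.lo g q := by
    intro q q' hq hq'
    by_cases hqq : q = q'
    · exact Or.inl hqq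
    · exact Or.inr (D.hdis g q q' hqq (hq.trans hq'.symm))
  rcases D.OL_int g e j h with ⟨q, hq, rfl⟩ | ⟨q, hq, rfl⟩ | rfl <;>
  rcases D.OL_int g e' j h' with ⟨q', hq', rfl⟩ | ⟨q', hq', rfl⟩ | rfl <;>
  simp at h1 h2 h3 h4 <;> try rfl
  · have := hlo q; have := hlo q'; have := hio q; have := hio q'
    rcases hd q q' hq hq' with rfl | h | h
    · rfl
    · omega
    · omega
  · have := hlo q; have := hlo q'; have := hio q; have := hio q'
    rcases hd q q' hq hq' with rfl | h | h <;> omega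
  · have := hmax q; rw [hq] at this; omega
  · have := hlo q; have := hlo q'; have := hio q; have := hio q'
    rcases hd q q' hq hq' with rfl | h | h <;> omega
  · have := hlo q; have := hlo q'; have := hio q; have := hio q'
    rcases hd q q' hq hq' with rfl | h | h
    · rfl
    · omega
    · omega
  · have := hio q; have := hmax q; rw [hq] at this; omega
  · have := hmax q'; rw [hq'] at this; omega
  · have := hio q'; have := hmax q'; rw [hq'] at this; omega

theorem exists_list (g) : ∀ (k : ℕ) (q : Q), D.r q < k → ∃ l : List D.gr.E,
    D.gr.IsPathFrom (D.S g) (D.vo q) l ∧ ∀ e ∈ l, D.OL g e (D.lab g q) := by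
  intro k
  induction k with
  | zero => intro q h; omega
  | succ k ih =>
    intro q hq
    have h2 : ∀ l : List D.gr.E, D.gr.IsPathFrom (D.S g) (D.vi q) l →
        (∀ e ∈ l, D.OL g e (D.lab g q)) → ∃ l : List D.gr.E,
        D.gr.IsPathFrom (D.S g) (D.vo q) l ∧ ∀ e ∈ l, D.OL g e (D.lab g q) := by
      intro l hl hl2
      refine ⟨l ++ [D.em q], path_snoc hl rfl rfl, ?_⟩
      intro e he
      rcases List.mem_append.1 he with he | he
      · exact hl2 e he
      · rw [List.mem_singleton.1 he]; rfl
    cases hp : D.pred g q with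
    | none =>
      refine h2 [D.el g q] (path_single ?_ rfl) ?_
      · rw [el_src, hp]; rfl
      · intro e he
        rw [List.mem_singleton.1 he]; exact ⟨rfl, rfl⟩
    | some p =>
      obtain ⟨l, hl, hl2⟩ := ih p (by have := D.hr g q p hp; omega)
      rw [D.hlab g q p hp] at hl2
      refine h2 (l ++ [D.el g q]) (path_snoc hl ?_ rfl) ?_
      · rw [el_src, hp]; rfl
      · intro e he
        rcases List.mem_append.1 he with he | he
        · exact hl2 e he
        · rw [List.mem_singleton.1 he]; exact ⟨rfl, rfl⟩

theorem exists_menger (g) : ∃ α : Fin (c g) → List D.gr.E,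
    D.gr.MengerSystem (D.S g) (D.R g) (c g) α := by
  choose l h1 h2 using fun q => D.exists_list g (D.r q + 1) q (Nat.lt_succ_self _)
  have h3 : ∀ j, ∀ e ∈ l (D.last g j) ++ [D.ee g j], D.OL g e j := by
    intro j e he
    rcases List.mem_append.1 he with he | he
    · have := h2 _ e he
      rwa [D.hlast] at this
    · rw [List.mem_singleton.1 he]; rfl
  refine ⟨fun j => l (D.last g j) ++ [D.ee g j], fun j => path_snoc (h1 _) rfl rfl, ?_⟩
  intro i j hij e hi hj
  exact hij (D.OL_unique g e i j (h3 i e hi) (h3 j e hj))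

theorem T_pos (q : Q) : 0 < D.T := by have := D.hT q; omega

theorem acyclic : D.gr.Acyclic := by
  intro v p hp
  refine lt_irrefl _ (path_mono D.rk ?_ p v hp)
  refine D.edge_cases ?_ ?_ ?_
  · intro q; exact Nat.lt_succ_self _
  · intro g q
    rw [el_src]
    show _ < 2 * D.r q + 1
    cases h : D.pred g q with
    | none => exact Nat.succ_pos _
    | some p =>
      have := D.hr g q p h
      show 2 * D.r p + 2 < _
      omega
  · intro g j
    show 2 * D.r _ + 2 < 2 * D.T + 3
    have := D.hT (D.last g j)
    omega

theorem minCut [Nonempty Q] (g) : D.gr.MinCut (D.S g) (D.R g) (c g) := by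
  obtain ⟨q⟩ := ‹Nonempty Q›
  refine ⟨D.exists_menger g, no_more (D.P g) (D.OL g) ?_ ?_ (D.hA g) (D.hB g)⟩
  · simp [P, S]
  · simpa [P, R] using D.T_pos q

theorem follow (g : Fin 2) {α : Fin (c g) → List D.gr.E}
    (hα : D.gr.MengerSystem (D.S g) (D.R g) (c g) α) (q : Q) :
    ∃ i, [D.el g q, D.em q] <:+: α i := by
  have hPR : D.P g (D.R g) = D.T := by simp [P, R]
  obtain ⟨i, hi⟩ := all_used (D.P g) (D.OL g) (by simp [P, S]) (D.hA g) (D.hB g) hα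
    (e := D.el g q) (k := D.lab g q) ⟨rfl, rfl⟩ (by simpa using D.lo_lt g q)
    (by
      have := D.lo_lt g q; have := D.hio g q; have := D.hoT g q
      rw [hPR, P_el_src]; omega)
  refine ⟨i, path_next (hα.1 i) hi ?_ ?_⟩
  · intro h; cases h
  · refine D.edge_cases ?_ ?_ ?_
    · intro q' h
      have h : D.vi q' = D.vi q := h
      have : q' = q := Sum.inl.inj (Sum.inr.inj h)
      rw [this]
    · intro g' q' h
      rw [el_src] at h
      have h : _ = D.vi q := h
      cases hp : D.pred g' q' <;> rw [hp] at h <;> cases h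
    · intro g' j h
      cases h

theorem lower (D : LData Q c) [Nonempty Q] : MAtLeast c (Fintype.card Q) := by
  classical
  refine ⟨D.gr, D.S, D.R, ⟨D.acyclic, ?_, D.minCut⟩, ?_, ?_⟩
  · intro a b h; exact Sum.inr.inj (Sum.inl.inj h)
  · intro a b h; exact Sum.inl.inj (Sum.inl.inj h)
  · intro α hα
    have := D.gr.fintE
    have hsub : Set.range D.em ⊆ {e | D.gr.MergingEdge α e} := by
      rintro _ ⟨q, rfl⟩
      obtain ⟨i, hi⟩ := D.follow 0 (hα 0) q
      obtain ⟨j, hj⟩ := D.follow 1 (hα 1) q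
      refine ⟨0, 1, by decide, i, j, _, _, ?_, hi, hj⟩
      intro h
      have := congrArg Prod.fst (Sum.inl.inj (Sum.inr.inj h))
      exact absurd this (zero_ne_one (α := Fin 2))
    have h1 := Set.ncard_le_ncard hsub (Set.toFinite _)
    have hinj : Function.Injective D.em := by
      intro a b h; exact Sum.inl.inj h
    rw [← Set.image_univ, Set.ncard_image_of_injective _ hinj, Set.ncard_univ,
      Nat.card_eq_fintype_card] at h1
    exact h1

end LData
end MTN
namespace MTN

/-- The points of the extremal graph. -/
abbrev QQ (m : ℕ) : Type := Fin (m + 2) ⊕ (Fin m ⊕ Fin m)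

section
variable {m : ℕ}

/-- predecessor on the first group -/
def p0 : QQ m → Option (QQ m)
  | .inl i =>
    if h0 : i.1 = 0 then none
    else if h1 : i.1 ≤ m then some (.inr (.inl ⟨i.1 - 1, by omega⟩))
    else if h2 : m = 0 then none
    else some (.inr (.inr ⟨m - 1, by omega⟩))
  | .inr (.inl j) => if h0 : j.1 = 0 then none else some (.inr (.inr ⟨j.1 - 1, by omega⟩))
  | .inr (.inr j) => some (.inl ⟨j.1, by omega⟩)

/-- predecessor on the second group -/
def p1 : QQ m → Option (QQ m)
  | .inl i => if h0 : i.1 = 0 then none else some (.inl ⟨i.1 - 1, by omega⟩)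
  | .inr (.inl j) => some (.inr (.inr j))
  | .inr (.inr _) => none

/-- first label -/
def l0 : QQ m → Fin 2
  | .inl i => ⟨i.1 % 2, by omega⟩
  | .inr (.inl j) => ⟨(j.1 + 1) % 2, by omega⟩
  | .inr (.inr j) => ⟨j.1 % 2, by omega⟩

/-- second label -/
def l1 : QQ m → Fin (m + 1)
  | .inl _ => 0
  | .inr (.inl j) => ⟨j.1 + 1, by omega⟩
  | .inr (.inr j) => ⟨j.1 + 1, by omega⟩

/-- first last point -/
def e0 (k : Fin 2) : QQ m :=
  if m % 2 = k.1 then .inl ⟨m, by omega⟩ else .inl ⟨m + 1, by omega⟩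

/-- second last point -/
def e1 (k : Fin (m + 1)) : QQ m :=
  if h : k.1 = 0 then .inl ⟨m + 1, by omega⟩ else .inr (.inl ⟨k.1 - 1, by omega⟩)

/-- rank -/
def rr : QQ m → ℕ
  | .inl i => 3 * i.1 + 1
  | .inr (.inl j) => 3 * j.1 + 3
  | .inr (.inr j) => 3 * j.1 + 2

/-- potential -/
def fi0 : QQ m → ℕ
  | .inl i => 6 * i.1 + 1
  | .inr (.inl j) => 6 * j.1 + 5
  | .inr (.inr j) => 6 * j.1 + 9

/-- potential -/
def fo0 : QQ m → ℕ
  | .inl i => 6 * i.1 + 8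
  | .inr (.inl j) => 6 * j.1 + 6
  | .inr (.inr j) => 6 * j.1 + 10

/-- potential -/
def fi1 : QQ m → ℕ
  | .inl i => 2 * i.1 + 1
  | .inr (.inl j) => 2 * m + 11 + 2 * (m - j.1)
  | .inr (.inr _) => 1

/-- potential -/
def fo1 : QQ m → ℕ
  | .inl i => 2 * i.1 + 2
  | .inr (.inl _) => 6 * m + 30
  | .inr (.inr j) => 2 * m + 10 + 2 * (m - j.1)

theorem p0_spec (q p : QQ m) (h : p0 q = some p) :
    rr p < rr q ∧ l0 p = l0 q ∧ fo0 p < fi0 q ∧ fi1 q ≤ fo1 p := by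
  rcases q with ⟨i, hi⟩ | ⟨j, hj⟩ | ⟨j, hj⟩ <;> simp only [p0] at h <;> (try split_ifs at h) <;>
    simp only [Option.some.injEq, reduceCtorEq] at h <;> subst h <;>
    simp only [rr, l0, fo0, fi0, fi1, fo1, Fin.mk.injEq] <;> refine ⟨?_, ?_, ?_, ?_⟩ <;> first | rfl | trivial | omega

theorem p1_spec (q p : QQ m) (h : p1 q = some p) :
    rr p < rr q ∧ l1 p = l1 q ∧ fo1 p < fi1 q ∧ fi0 q ≤ fo0 p := by
  rcases q with ⟨i, hi⟩ | ⟨j, hj⟩ | ⟨j, hj⟩ <;> simp only [p1] at h <;> (try split_ifs at h) <;>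
    simp only [Option.some.injEq, reduceCtorEq] at h <;> subst h <;>
    simp only [rr, l1, fo0, fi0, fi1, fo1] <;> refine ⟨?_, ?_, ?_, ?_⟩ <;> first | rfl | trivial | omega

theorem dis0 (q q' : QQ m) (hne : q ≠ q') (h : l0 q = l0 q') :
    fo0 q ≤ (p0 q').elim 0 fo0 ∨ fo0 q' ≤ (p0 q).elim 0 fo0 := by
  rcases q with ⟨i, hi⟩ | ⟨j, hj⟩ | ⟨j, hj⟩ <;> rcases q' with ⟨i', hi'⟩ | ⟨j', hj'⟩ | ⟨j', hj'⟩ <;>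
    simp only [l0, Fin.mk.injEq, ne_eq, Sum.inl.injEq, Sum.inr.injEq] at h hne <;>
    simp only [p0] <;> (try split_ifs) <;>
    simp only [fo0, Option.elim_none, Option.elim_some] <;> omega

theorem dis1 (q q' : QQ m) (hne : q ≠ q') (h : l1 q = l1 q') :
    fo1 q ≤ (p1 q').elim 0 fo1 ∨ fo1 q' ≤ (p1 q).elim 0 fo1 := by
  rcases q with ⟨i, hi⟩ | ⟨j, hj⟩ | ⟨j, hj⟩ <;> rcases q' with ⟨i', hi'⟩ | ⟨j', hj'⟩ | ⟨j', hj'⟩ <;>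
    simp only [l1, Fin.ext_iff, Fin.val_zero, ne_eq, Sum.inl.injEq, Sum.inr.injEq] at h hne <;>
    simp only [p1] <;> (try split_ifs) <;>
    simp only [fo1, Option.elim_none, Option.elim_some] <;> omega

theorem fo0_e0 (k : Fin 2) : m % 2 = k.1 ∧ fo0 (e0 k : QQ m) = 6 * m + 8 ∨
    m % 2 ≠ k.1 ∧ fo0 (e0 k : QQ m) = 6 * m + 14 := by
  by_cases h : m % 2 = k.1
  · left; refine ⟨h, ?_⟩; rw [e0, if_pos h]; rfl
  · right; refine ⟨h, ?_⟩; rw [e0, if_neg h]; simp only [fo0]; omega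

theorem max0 (q : QQ m) : fo0 q ≤ fo0 (e0 (l0 q) : QQ m) := by
  have := fo0_e0 (m := m) (l0 q)
  have h2 : fo0 q ≤ 6 * m + 8 ∨ fo0 q ≤ 6 * m + 14 ∧ (m + 1) % 2 = (l0 q).1 := by
    rcases q with ⟨i, hi⟩ | ⟨j, hj⟩ | ⟨j, hj⟩ <;> simp only [l0, fo0] <;> omega
  omega

theorem max1 (q : QQ m) : fo1 q ≤ fo1 (e1 (l1 q) : QQ m) := by
  rcases q with ⟨i, hi⟩ | ⟨j, hj⟩ | ⟨j, hj⟩ <;> simp only [l1, e1] <;> split_ifs <;>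
    simp only [fo1] <;> simp at * <;> omega

theorem last0 (k : Fin 2) : l0 (e0 k : QQ m) = k := by
  unfold e0
  split_ifs <;> simp only [l0, Fin.ext_iff] <;> omega

theorem last1 (k : Fin (m + 1)) : l1 (e1 k : QQ m) = k := by
  unfold e1
  split_ifs <;> simp only [l1, Fin.ext_iff, Fin.val_zero] <;> omega

theorem bnd (q : QQ m) : rr q < 6 * m + 40 ∧ 0 < fi0 q ∧ 0 < fi1 q ∧ fi0 q < fo0 q ∧ fi1 q < fo1 q ∧
    fo0 q < 6 * m + 40 ∧ fo1 q < 6 * m + 40 := by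
  rcases q with ⟨i, hi⟩ | ⟨j, hj⟩ | ⟨j, hj⟩ <;> simp only [rr, fi0, fo0, fi1, fo1] <;>
    refine ⟨?_, ?_, ?_, ?_, ?_, ?_, ?_⟩ <;> omega

end

/-- The extremal data. -/
def dat (m : ℕ) : LData (QQ m) ![2, m + 1] where
  pred := fun g => match g with | 0 => p0 | 1 => p1
  last := fun g => match g with | 0 => e0 | 1 => e1
  lab := fun g => match g with | 0 => l0 | 1 => l1
  r := rr
  fi := fun g => match g with | 0 => fi0 | 1 => fi1
  fo := fun g => match g with | 0 => fo0 | 1 => fo1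
  T := 6 * m + 40
  hr := Fin.forall_fin_two.2 ⟨fun q p h => (p0_spec q p h).1, fun q p h => (p1_spec q p h).1⟩
  hT := fun q => (bnd q).1
  hlab := Fin.forall_fin_two.2 ⟨fun q p h => (p0_spec q p h).2.1, fun q p h => (p1_spec q p h).2.1⟩
  hlast := Fin.forall_fin_two.2 ⟨last0, last1⟩
  hpos := Fin.forall_fin_two.2 ⟨fun q => (bnd q).2.1, fun q => (bnd q).2.2.1⟩
  hio := Fin.forall_fin_two.2 ⟨fun q => (bnd q).2.2.2.1, fun q => (bnd q).2.2.2.2.1⟩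
  hoT := Fin.forall_fin_two.2 ⟨fun q => (bnd q).2.2.2.2.2.1, fun q => (bnd q).2.2.2.2.2.2⟩
  hown := Fin.forall_fin_two.2
    ⟨fun q p h => (p0_spec q p h).2.2.1, fun q p h => (p1_spec q p h).2.2.1⟩
  hoth := Fin.forall_fin_two.2
    ⟨Fin.forall_fin_two.2 ⟨fun _ _ h => absurd rfl h, fun q p _ h => (p1_spec q p h).2.2.2⟩,
     Fin.forall_fin_two.2 ⟨fun q p _ h => (p0_spec q p h).2.2.2, fun _ _ h => absurd rfl h⟩⟩
  hdis := Fin.forall_fin_two.2 ⟨dis0, dis1⟩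
  hmax := Fin.forall_fin_two.2 ⟨max0, max1⟩

theorem lower (n : ℕ) (hn : 0 < n) : MAtLeast ![2, n] (3 * n - 1) := by
  obtain ⟨m, rfl⟩ : ∃ m, n = m + 1 := ⟨n - 1, by omega⟩
  have : Nonempty (QQ m) := ⟨.inl 0⟩
  have h := (dat m).lower
  have hc : Fintype.card (QQ m) = 3 * (m + 1) - 1 := by
    simp only [QQ, Fintype.card_sum, Fintype.card_fin]
    omega
  rwa [hc] at h

end MTN

/-- For every positive integer `n`, `M(2, n) = 3n − 1`. -/
theorem M_two_n (n : ℕ) (hn : 0 < n) : MEq ![2, n] (3 * n - 1) := by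
  exact ⟨MTN.upper n hn, MTN.lower n hn⟩
end

section
/- M*(4,4) = 9. That is, over all acyclic directed graphs G with a single source S and two distinct sinks R_1, R_2 in which the min-cut from S to each of R_1 and R_2 is 4, the largest possible value of the minimum number of mergings between a set of 4 edge-disjoint paths from S to R_1 and a set of 4 edge-disjoint paths from S to R_2 (minimized over all choices of the two Menger path systems) equals 9. -/
open MultiDigraph

namespace MS

abbrev Mx := Fin 4 → Fin 4 → Bool

def idM : Mx := fun i j => decide (i = j)

def stA (A : Mx) (i j : Fin 4) : Mx := fun p q =>
  if p = i then (if q = j then true else A i q)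
  else if q = j then false else (A p q || (A p j && A i q))

def stB (B : Mx) (i j : Fin 4) : Mx := fun p q =>
  if q = j then (if p = i then true else B p j)
  else if p = i then false else (B p q || (B i q && B p j))

inductive Run : ℕ → Mx → Mx → Prop
  | init : Run 0 idM idM
  | step {n : ℕ} {A B : Mx} (i j : Fin 4) (h : Run n A B) (hA : A i j = false)
      (hB : B i j = false) : Run (n + 1) (stA A i j) (stB B i j)

/-- index type that reduces quickly -/
inductive I4 | a | b | c | d

def I4.fin : I4 → Fin 4
  | .a => 0 | .b => 1 | .c => 2 | .d => 3

def I4.eq : I4 → I4 → Bool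
  | .a, .a => true | .b, .b => true | .c, .c => true | .d, .d => true | _, _ => false

def I4.all (f : I4 → Bool) : Bool := f .a && (f .b && (f .c && f .d))

structure Rw where
  a : Bool
  b : Bool
  c : Bool
  d : Bool

structure Mt where
  a : Rw
  b : Rw
  c : Rw
  d : Rw

def Rw.get (r : Rw) : I4 → Bool
  | .a => r.a | .b => r.b | .c => r.c | .d => r.d
def Mt.row (r : Mt) : I4 → Rw
  | .a => r.a | .b => r.b | .c => r.c | .d => r.d
def Mt.get (m : Mt) (i j : I4) : Bool := (m.row i).get j

def force {α : Type} (b : Bool) (f : Bool → α) : α := match b with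
  | true => f true
  | false => f false

theorem force_eq {α : Type} (b : Bool) (f : Bool → α) : force b f = f b := by cases b <;> rfl

def mkR {α : Type} (f : I4 → Bool) (k : Rw → α) : α :=
  force (f .a) fun a => force (f .b) fun b => force (f .c) fun c => force (f .d) fun d => k ⟨a, b, c, d⟩

def mkM {α : Type} (f : I4 → I4 → Bool) (k : Mt → α) : α :=
  mkR (f .a) fun a => mkR (f .b) fun b => mkR (f .c) fun c => mkR (f .d) fun d => k ⟨a, b, c, d⟩

def toM (f : I4 → I4 → Bool) : Mt :=
  ⟨⟨f .a .a, f .a .b, f .a .c, f .a .d⟩, ⟨f .b .a, f .b .b, f .b .c, f .b .d⟩,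
   ⟨f .c .a, f .c .b, f .c .c, f .c .d⟩, ⟨f .d .a, f .d .b, f .d .c, f .d .d⟩⟩

theorem mkM_eq {α : Type} (f : I4 → I4 → Bool) (k : Mt → α) : mkM f k = k (toM f) := by
  simp only [mkM, mkR, force_eq, toM]

theorem toM_get (f : I4 → I4 → Bool) (i j : I4) : (toM f).get i j = f i j := by
  cases i <;> cases j <;> rfl

def fA (A : Mt) (i j : I4) : I4 → I4 → Bool := fun p q =>
  cond (p.eq i) (cond (q.eq j) true (A.get i q))
   (cond (q.eq j) false (or (A.get p q) (and (A.get p j) (A.get i q))))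

def fB (B : Mt) (i j : I4) : I4 → I4 → Bool := fun p q =>
  cond (q.eq j) (cond (p.eq i) true (B.get p j))
   (cond (p.eq i) false (or (B.get p q) (and (B.get i q) (B.get p j))))

def ok : ℕ → Mt → Mt → Bool
  | 0, A, B => I4.all fun i => I4.all fun j => or (A.get i j) (B.get i j)
  | n + 1, A, B => I4.all fun i => I4.all fun j => or (or (A.get i j) (B.get i j))
      (mkM (fA A i j) fun A' => mkM (fB B i j) fun B' => ok n A' B')

def idT : Mt := ⟨⟨true, false, false, false⟩, ⟨false, true, false, false⟩,
  ⟨false, false, true, false⟩, ⟨false, false, false, true⟩⟩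

set_option maxRecDepth 100000 in
theorem ok8 : ok 8 (toM (fA idT .a .b)) (toM (fB idT .a .b)) = true := by decide +kernel

def rep (A : Mt) (A' : Mx) : Prop := ∀ i j : I4, A.get i j = A' i.fin j.fin

theorem fin_surj (i : Fin 4) : ∃ k : I4, k.fin = i := by
  fin_cases i
  · exact ⟨.a, rfl⟩
  · exact ⟨.b, rfl⟩
  · exact ⟨.c, rfl⟩
  · exact ⟨.d, rfl⟩

theorem I4.eq_iff (i j : I4) : i.eq j = decide (i.fin = j.fin) := by
  cases i <;> cases j <;> decide

theorem all_iff (f : I4 → Bool) : I4.all f = true ↔ ∀ i, f i = true := by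
  constructor
  · intro h i
    simp only [I4.all, Bool.and_eq_true] at h
    cases i <;> tauto
  · intro h
    simp [I4.all, h]

theorem rep_A {A : Mt} {A' : Mx} (h : rep A A') (i j : I4) :
    rep (toM (fA A i j)) (stA A' i.fin j.fin) := by
  intro p q
  rw [toM_get]
  simp only [fA, stA, I4.eq_iff, h _ _, Bool.cond_decide]

theorem rep_B {A : Mt} {A' : Mx} (h : rep A A') (i j : I4) :
    rep (toM (fB A i j)) (stB A' i.fin j.fin) := by
  intro p q
  rw [toM_get]
  simp only [fB, stB, I4.eq_iff, h _ _, Bool.cond_decide]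

/-- runs whose first move is (0,1) -/
inductive RunF : ℕ → Mx → Mx → Prop
  | init : RunF 0 (stA idM 0 1) (stB idM 0 1)
  | step {n : ℕ} {A B : Mx} (i j : Fin 4) (h : RunF n A B) (hA : A i j = false)
      (hB : B i j = false) : RunF (n + 1) (stA A i j) (stB B i j)

def cj (A : Mx) (π : Equiv.Perm (Fin 4)) : Mx := fun p q => A (π p) (π q)

theorem cj_A (A : Mx) (π : Equiv.Perm (Fin 4)) (i j : Fin 4) :
    cj (stA A (π i) (π j)) π = stA (cj A π) i j := by
  funext p q
  simp only [cj, stA, π.injective.eq_iff]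

theorem cj_B (A : Mx) (π : Equiv.Perm (Fin 4)) (i j : Fin 4) :
    cj (stB A (π i) (π j)) π = stB (cj A π) i j := by
  funext p q
  simp only [cj, stB, π.injective.eq_iff]

theorem cj_id (π : Equiv.Perm (Fin 4)) : cj idM π = idM := by
  funext p q
  simp only [cj, idM, π.injective.eq_iff]

theorem perm01 : ∀ i j : Fin 4, i ≠ j → ∃ π : Equiv.Perm (Fin 4), π 0 = i ∧ π 1 = j := by
  intro i j hij
  refine ⟨Equiv.swap (Equiv.swap 0 i 1) j * Equiv.swap 0 i, ?_, ?_⟩ <;> revert i j <;> decide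

theorem run_runF {n : ℕ} {A B : Mx} (h : Run n A B) :
    (n = 0 ∧ A = idM ∧ B = idM) ∨ ∃ m, n = m + 1 ∧ ∃ π, RunF m (cj A π) (cj B π) := by
  induction h with
  | init => exact Or.inl ⟨rfl, rfl, rfl⟩
  | @step n A B i j h hA hB ih =>
    right
    refine ⟨n, rfl, ?_⟩
    rcases ih with ⟨rfl, rfl, rfl⟩ | ⟨m, rfl, π, hr⟩
    · have hij : i ≠ j := by
        rintro rfl
        simp [idM] at hA
      obtain ⟨π, rfl, rfl⟩ := perm01 i j hij
      refine ⟨π, ?_⟩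
      rw [cj_A, cj_B, cj_id]
      exact RunF.init
    · refine ⟨π, ?_⟩
      obtain ⟨i, rfl⟩ := π.surjective i
      obtain ⟨j, rfl⟩ := π.surjective j
      rw [cj_A, cj_B]
      exact RunF.step i j hr hA hB

theorem runF_ok {n : ℕ} {A B : Mx} (h : RunF n A B) :
    n ≤ 8 ∧ ∃ A' B', rep A' A ∧ rep B' B ∧ ok (8 - n) A' B' = true := by
  induction h with
  | init =>
    have h : rep idT idM := by intro i j; cases i <;> cases j <;> rfl
    exact ⟨by norm_num, _, _, rep_A h .a .b, rep_B h .a .b, ok8⟩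
  | @step n A B i j h hA hB ih =>
    obtain ⟨hn, A', B', rA, rB, hok⟩ := ih
    obtain ⟨i, rfl⟩ := fin_surj i
    obtain ⟨j, rfl⟩ := fin_surj j
    obtain ⟨m, hm⟩ : ∃ m, m = 8 - n := ⟨_, rfl⟩
    rw [← hm] at hok
    cases m with
    | zero =>
      exfalso
      simp only [ok, all_iff] at hok
      have := hok i j
      rw [rA, rB, hA, hB] at this
      simp at this
    | succ m =>
      simp only [ok, all_iff] at hok
      have := hok i j
      rw [rA, rB, hA, hB, mkM_eq, mkM_eq] at this
      refine ⟨by omega, _, _, rep_A rA i j, rep_B rB i j, ?_⟩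
      have e : 8 - (n + 1) = m := by omega
      rw [e]
      simpa using this

theorem run_le {n : ℕ} {A B : Mx} (h : Run n A B) : n ≤ 9 := by
  rcases run_runF h with ⟨rfl, -, -⟩ | ⟨m, rfl, π, hr⟩
  · norm_num
  · have := (runF_ok hr).1
    omega

end MS
namespace MS

open MultiDigraph Sum

structure Sys (G : MultiDigraph) (S R : G.V) (n : ℕ) (a : Equiv.Perm (Fin n ⊕ G.E)) : Prop where
  st : ∀ i, ∃ e, a (inl i) = inr e ∧ G.src e = S
  nx : ∀ e e', a (inr e) = inr e' → e' = e ∨ G.dst e = G.src e'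
  en : ∀ e i, a (inr e) = inl i → G.dst e = R

def Mg {ι E : Type} (a b : Equiv.Perm (ι ⊕ E)) (e : E) : Prop :=
  ∃ f g, f ≠ g ∧ f ≠ e ∧ g ≠ e ∧ a (inr f) = inr e ∧ b (inr g) = inr e

theorem Mg.symm {ι E : Type} {a b : Equiv.Perm (ι ⊕ E)} {e : E} (h : Mg a b e) : Mg b a e := by
  obtain ⟨f, g, h1, h2, h3, h4, h5⟩ := h
  exact ⟨g, f, h1.symm, h3, h2, h5, h4⟩

def Tr {ι E : Type} (b : Equiv.Perm (ι ⊕ E)) (x c : ι ⊕ E) : Prop :=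
  (∃ e, x = inr e ∧ c = inr e) ∨ (∃ e, c = inr e ∧ b x = inr e)

def Res {ι E : Type} (a b : Equiv.Perm (ι ⊕ E)) (x y : ι ⊕ E) : Prop := Tr b x (a y)

theorem chain_of_rtg {α : Type} {r : α → α → Prop} {x y : α} (h : Relation.ReflTransGen r x y) :
    ∃ l : List α, (x :: l).Nodup ∧ (x :: l).IsChain r ∧ (x :: l).getLast? = some y := by
  induction h using Relation.ReflTransGen.head_induction_on with
  | refl => exact ⟨[], by simp, by simp, by simp⟩
  | @head a c hac _ ih =>
    obtain ⟨l, hn, hc, hl⟩ := ih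
    by_cases ha : a ∈ c :: l
    · obtain ⟨s, t, hst⟩ := List.append_of_mem ha
      rw [hst] at hn hc hl
      refine ⟨t, hn.of_append_right, hc.right_of_append, ?_⟩
      simpa using hl
    · refine ⟨c :: l, List.nodup_cons.2 ⟨ha, hn⟩, ?_, by simpa using hl⟩
      simp [hac, hc]

theorem perm_of_chain {α : Type} {r : α → α → Prop} (y : α) :
    ∀ (l : List α) (x : α), (x :: l).Nodup → (x :: l).IsChain r → (x :: l).getLast? = some y →
    ∃ π : Equiv.Perm α, π y = x ∧ (∀ z, z ∉ x :: l → π z = z) ∧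
      ∀ z, z ≠ y → π z = z ∨ r z (π z) := by
  classical
  intro l
  induction l with
  | nil =>
    intro x _ _ h
    simp at h
    subst h
    exact ⟨1, by simp⟩
  | cons c l ih =>
    intro x hn hc hl
    obtain ⟨π, h1, h2, h3⟩ := ih c (List.nodup_cons.1 hn).2 (by simp at hc; exact hc.2) (by simpa using hl)
    have hx : x ∉ c :: l := (List.nodup_cons.1 hn).1
    have hy : y ∈ c :: l := List.mem_of_getLast? (by simpa using hl)
    have hxy : x ≠ y := fun h => hx (h ▸ hy)
    refine ⟨π * Equiv.swap x y, ?_, ?_, ?_⟩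
    · simp [h2 x hx]
    · intro z hz
      have hzx : z ≠ x := by rintro rfl; simp at hz
      have hzl : z ∉ c :: l := fun h => hz (List.mem_cons_of_mem _ h)
      have hzy : z ≠ y := by rintro rfl; exact hzl hy
      simp [Equiv.swap_apply_of_ne_of_ne hzx hzy, h2 z hzl]
    · intro z hz
      by_cases hzx : z = x
      · subst hzx
        right
        simp only [Equiv.Perm.mul_apply, Equiv.swap_apply_left, h1]
        simp at hc
        exact hc.1
      · simp only [Equiv.Perm.mul_apply, Equiv.swap_apply_of_ne_of_ne hzx hz]
        exact h3 z hz

theorem reroute {G : MultiDigraph} {S R R' : G.V} {n : ℕ} {a b : Equiv.Perm (Fin n ⊕ G.E)}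
    (ha : Sys G S R n a) (hb : Sys G S R' n b) {e f g : G.E} (_hfg : f ≠ g)
    (haf : a (inr f) = inr e) (hbg : b (inr g) = inr e)
    (hp : Relation.ReflTransGen (Res a b) (inr f) (inr g)) :
    ∃ a' : Equiv.Perm (Fin n ⊕ G.E), Sys G S R n a' ∧ (∀ e', Mg a' b e' → Mg a b e') ∧
      ¬ Mg a' b e := by
  obtain ⟨l, h1, h2, h3⟩ := chain_of_rtg hp
  obtain ⟨π, p1, -, p3⟩ := perm_of_chain _ l _ h1 h2 h3
  have key : ∀ x, a (π x) = a x ∨ Tr b x (a (π x)) := by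
    intro x
    by_cases hx : x = inr g
    · subst hx
      right; right
      exact ⟨e, by rw [p1, haf], hbg⟩
    · rcases p3 x hx with h | h
      · left; rw [h]
      · right; exact h
  refine ⟨a * π, ⟨?_, ?_, ?_⟩, ?_, ?_⟩
  · intro i
    simp only [Equiv.Perm.mul_apply]
    rcases key (inl i) with h | ⟨e', h, -⟩ | ⟨e', h, h'⟩
    · rw [h]; exact ha.st i
    · simp at h
    · obtain ⟨e2, h4, h5⟩ := hb.st i
      refine ⟨e', h, ?_⟩
      rw [h'] at h4
      cases h4
      exact h5
  · intro e1 e2 h0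
    simp only [Equiv.Perm.mul_apply] at h0
    rcases key (inr e1) with h | ⟨e', h, h'⟩ | ⟨e', h, h'⟩
    · rw [h] at h0; exact ha.nx _ _ h0
    · rw [h'] at h0; cases h; cases h0; exact Or.inl rfl
    · rw [h] at h0; cases h0; exact hb.nx _ _ h'
  · intro e1 i h0
    simp only [Equiv.Perm.mul_apply] at h0
    rcases key (inr e1) with h | ⟨e', h, h'⟩ | ⟨e', h, h'⟩
    · rw [h] at h0; exact ha.en _ _ h0
    · rw [h'] at h0; cases h0
    · rw [h] at h0; cases h0
  · rintro e' ⟨f', g', q1, q2, q3, q4, q5⟩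
    simp only [Equiv.Perm.mul_apply] at q4
    rcases key (inr f') with h | ⟨e', h, h'⟩ | ⟨e', h, h'⟩
    · exact ⟨f', g', q1, q2, q3, by rw [← h, q4], q5⟩
    · rw [h'] at q4; cases h; cases q4; exact absurd rfl q2
    · rw [h] at q4; cases q4
      rw [← q5] at h'
      exact absurd (inr_injective (b.injective h')) q1
  · rintro ⟨f', g', q1, q2, q3, q4, q5⟩
    have e1 : (a * π) (inr g) = inr e := by rw [Equiv.Perm.mul_apply, p1, haf]
    rw [← e1] at q4
    rw [← hbg] at q5
    have := inr_injective ((a * π).injective q4)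
    have := inr_injective (b.injective q5)
    subst f' g'
    exact q1 rfl

end MS
namespace MS

open MultiDigraph Sum

theorem exists_rank (G : MultiDigraph) (h : G.Acyclic) :
    ∃ r : G.V → ℕ, ∀ e, r (G.src e) < r (G.dst e) := by
  classical
  have := G.fintV
  let adj : G.V → G.V → Prop := fun u v => ∃ e, G.src e = u ∧ G.dst e = v
  have hpath : ∀ u v, Relation.TransGen adj u v → ∃ p, G.IsPathFrom u v p := by
    intro u v huv
    induction huv using Relation.TransGen.head_induction_on with
    | @single a h =>
      obtain ⟨e, rfl, rfl⟩ := h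
      exact ⟨[e], by simp, List.isChain_singleton _, by simp, by simp⟩
    | @head a c hac _ ih =>
      obtain ⟨e, rfl, rfl⟩ := hac
      obtain ⟨p, h1, h2, h3, h4⟩ := ih
      cases p with
      | nil => exact absurd rfl h1
      | cons f p =>
        refine ⟨e :: f :: p, by simp, ?_, by simp, ?_⟩
        · simp only [List.head?_cons, Option.mem_def, Option.some.injEq, forall_eq'] at h3
          have h2' : List.IsChain (fun e f => G.dst e = G.src f) (f :: p) := h2
          have : List.IsChain (fun e f => G.dst e = G.src f) (e :: f :: p) := by
            simp only [List.isChain_cons_cons]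
            exact ⟨h3.symm, h2'⟩
          exact this
        · simpa using h4
  refine ⟨fun v => (Finset.univ.filter fun u => Relation.TransGen adj u v).card, ?_⟩
  intro e
  apply Finset.card_lt_card
  have he : adj (G.src e) (G.dst e) := ⟨e, rfl, rfl⟩
  rw [Finset.ssubset_iff_of_subset]
  · refine ⟨G.src e, by simpa using Relation.TransGen.single he, ?_⟩
    simp only [Finset.mem_filter, Finset.mem_univ, true_and]
    intro hc
    obtain ⟨p, hp⟩ := hpath _ _ hc
    exact h _ p hp
  · intro u hu
    simp only [Finset.mem_filter, Finset.mem_univ, true_and] at hu ⊢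
    exact hu.tail he

theorem path_nodup {G : MultiDigraph} {r : G.V → ℕ} (hr : ∀ e, r (G.src e) < r (G.dst e))
    {u v : G.V} {p : List G.E} (hp : G.IsPathFrom u v p) : p.Nodup := by
  obtain ⟨-, h2, -⟩ := hp
  have h2' : List.IsChain (fun e f => G.dst e = G.src f) p := h2
  have h3 : List.IsChain (fun e f => r (G.src e) < r (G.src f)) p :=
    h2'.imp fun e f h => by rw [← h]; exact hr e
  have : Std.Irrefl (fun e f : G.E => r (G.src e) < r (G.src f)) := ⟨fun e => lt_irrefl _⟩
  have : IsTrans G.E (fun e f : G.E => r (G.src e) < r (G.src f)) := ⟨fun e f g => lt_trans⟩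
  have h4 := List.isChain_iff_pairwise.1 h3
  exact h4.imp fun {x y} h => by rintro rfl; exact lt_irrefl _ h

theorem cyc {G : MultiDigraph} {n : ℕ} (i : Fin n) (v : G.V) :
    ∀ (p : List G.E) (u : G.V), p.Nodup → G.IsPathFrom u v p →
    ∃ c : Equiv.Perm (Fin n ⊕ G.E), (∀ k, k ≠ i → c (inl k) = inl k) ∧
      (∀ e, e ∉ p → c (inr e) = inr e) ∧ (∃ e ∈ p, c (inl i) = inr e ∧ G.src e = u) ∧
      (∀ e e', c (inr e) = inr e' → e' = e ∨ (e' ∈ p ∧ G.dst e = G.src e')) ∧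
      (∀ e k, c (inr e) = inl k → k = i ∧ G.dst e = v) := by
  classical
  intro p
  induction p with
  | nil => intro u _ h; exact absurd rfl h.1
  | cons e p ih =>
    intro u hn ⟨_, h2, h3, h4⟩
    have h2' : List.IsChain (fun e f => G.dst e = G.src f) (e :: p) := h2
    simp only [List.head?_cons, Option.mem_def, Option.some.injEq, forall_eq'] at h3
    cases p with
    | nil =>
      refine ⟨Equiv.swap (inl i) (inr e), ?_, ?_, ?_, ?_, ?_⟩
      · intro k hk
        exact Equiv.swap_apply_of_ne_of_ne (by simpa using hk) (by simp)
      · intro e' he'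
        exact Equiv.swap_apply_of_ne_of_ne (by simp) (by simpa using he')
      · exact ⟨e, by simp, by simp, h3⟩
      · intro e1 e2 h
        by_cases h1 : e1 = e
        · subst h1; simp at h
        · rw [Equiv.swap_apply_of_ne_of_ne (by simp) (by simpa using h1)] at h
          cases h; exact Or.inl rfl
      · intro e1 k h
        by_cases h1 : e1 = e
        · subst h1; simp at h; simp at h4; exact ⟨h.symm, h4⟩
        · rw [Equiv.swap_apply_of_ne_of_ne (by simp) (by simpa using h1)] at h
          cases h
    | cons f p =>
      rw [List.isChain_cons_cons] at h2'
      obtain ⟨c, c1, c2, ⟨e0, c3, c3', c3''⟩, c4, c5⟩ := ih (G.dst e) (List.nodup_cons.1 hn).2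
        ⟨by simp, h2'.2, by simp [h2'.1], by simpa using h4⟩
      have hen := (List.nodup_cons.1 hn).1
      have sw : ∀ x, x ≠ e → (c * Equiv.swap (inl i) (inr e)) (inr x) = c (inr x) := by
        intro x hx
        rw [Equiv.Perm.mul_apply, Equiv.swap_apply_of_ne_of_ne (by simp) (by simpa using hx)]
      have swe : (c * Equiv.swap (inl i) (inr e)) (inr e) = inr e0 := by
        rw [Equiv.Perm.mul_apply, Equiv.swap_apply_right, c3']
      refine ⟨c * Equiv.swap (inl i) (inr e), ?_, ?_, ?_, ?_, ?_⟩
      · intro k hk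
        rw [Equiv.Perm.mul_apply, Equiv.swap_apply_of_ne_of_ne (by simpa using hk) (by simp)]
        exact c1 k hk
      · intro e' he'
        rw [List.mem_cons, not_or] at he'
        rw [sw _ he'.1, c2 _ he'.2]
      · exact ⟨e, by simp, by simp [c2 e hen], h3⟩
      · intro e1 e2 h
        by_cases h1 : e1 = e
        · subst h1
          rw [swe] at h
          cases h
          exact Or.inr ⟨List.mem_cons_of_mem _ c3, c3''.symm⟩
        · rw [sw _ h1] at h
          rcases c4 _ _ h with h | ⟨h, h'⟩
          · exact Or.inl h
          · exact Or.inr ⟨List.mem_cons_of_mem _ h, h'⟩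
      · intro e1 k h
        by_cases h1 : e1 = e
        · subst h1
          rw [swe] at h
          cases h
        · rw [sw _ h1] at h
          exact c5 _ _ h

theorem sys_of_menger {G : MultiDigraph} {r : G.V → ℕ} (hr : ∀ e, r (G.src e) < r (G.dst e))
    {S R : G.V} {n : ℕ} {α : Fin n → List G.E} (h : G.MengerSystem S R n α) :
    ∃ a, Sys G S R n a := by
  classical
  have key : ∀ m, m ≤ n → ∃ a : Equiv.Perm (Fin n ⊕ G.E),
      (∀ i : Fin n, i.1 < m → ∃ e, a (inl i) = inr e ∧ G.src e = S) ∧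
      (∀ i : Fin n, m ≤ i.1 → a (inl i) = inl i) ∧
      (∀ e, (∀ i : Fin n, i.1 < m → e ∉ α i) → a (inr e) = inr e) ∧
      (∀ e e', a (inr e) = inr e' → e' = e ∨ G.dst e = G.src e') ∧
      (∀ e k, a (inr e) = inl k → G.dst e = R) := by
    intro m
    induction m with
    | zero =>
      intro _
      refine ⟨1, by simp, by simp, by simp, ?_, by simp⟩
      intro e e' h
      left
      simpa using h.symm
    | succ m ih =>
      intro hm
      obtain ⟨a, a1, a2, a3, a4, a5⟩ := ih (by omega)
      let i : Fin n := ⟨m, by omega⟩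
      obtain ⟨c, c1, c2, ⟨e0, c3, c3', c3''⟩, c4, c5⟩ :=
        cyc i R (α i) S (path_nodup hr (h.1 i)) (h.1 i)
      have afix : ∀ e ∈ α i, a (inr e) = inr e := by
        intro e he
        apply a3
        intro k hk
        refine h.2 i k ?_ e he
        intro hik
        rw [← hik] at hk
        exact lt_irrefl _ hk
      refine ⟨a * c, ?_, ?_, ?_, ?_, ?_⟩
      · intro k hk
        by_cases hki : k = i
        · subst hki
          exact ⟨e0, by rw [Equiv.Perm.mul_apply, c3', afix _ c3], c3''⟩
        · have : k.1 ≠ m := fun hh => hki (Fin.ext hh)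
          rw [Equiv.Perm.mul_apply, c1 k hki]
          exact a1 k (by omega)
      · intro k hk
        have hki : k ≠ i := by
          rintro rfl
          simp [i] at hk
        rw [Equiv.Perm.mul_apply, c1 k hki]
        exact a2 k (by omega)
      · intro e he
        rw [Equiv.Perm.mul_apply, c2 e (he i (by simp [i]))]
        exact a3 e fun k hk => he k (by omega)
      · intro e e' hh
        rw [Equiv.Perm.mul_apply] at hh
        rcases hce : c (inr e) with k | x
        · rw [hce] at hh
          obtain ⟨rfl, -⟩ := c5 _ _ hce
          rw [a2 _ (by simp [i])] at hh
          cases hh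
        · rw [hce] at hh
          rcases c4 _ _ hce with rfl | ⟨hx, hx'⟩
          · exact a4 _ _ hh
          · rw [afix _ hx] at hh
            cases hh
            exact Or.inr hx'
      · intro e k hh
        rw [Equiv.Perm.mul_apply] at hh
        rcases hce : c (inr e) with k' | x
        · exact (c5 _ _ hce).2
        · rw [hce] at hh
          rcases c4 _ _ hce with rfl | ⟨hx, hx'⟩
          · exact a5 _ _ hh
          · rw [afix _ hx] at hh
            cases hh
  obtain ⟨a, a1, -, -, a4, a5⟩ := key n le_rfl
  exact ⟨a, fun i => a1 i i.2, a4, a5⟩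

inductive From {ι E : Type} (a : Equiv.Perm (ι ⊕ E)) (i : ι) : E → Prop
  | first {e : E} : a (inl i) = inr e → From a i e
  | next {f e : E} : From a i f → a (inr f) = inr e → f ≠ e → From a i e

theorem From.unique {ι E : Type} {a : Equiv.Perm (ι ⊕ E)} {i j : ι} {e : E} (h : From a i e)
    (h' : From a j e) : i = j := by
  induction h with
  | first h =>
    cases h' with
    | first h2 => exact inl_injective (a.injective (h.trans h2.symm))
    | next _ h2 _ => exact absurd (a.injective (h.trans h2.symm)) (by simp)
  | next _ h _ ih =>
    cases h' with
    | first h2 => exact absurd (a.injective (h.trans h2.symm)) (by simp)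
    | next h3 h2 _ =>
      have := inr_injective (a.injective (h.trans h2.symm))
      subst this
      exact ih h3

theorem walk {G : MultiDigraph} {r : G.V → ℕ} (hr : ∀ e, r (G.src e) < r (G.dst e))
    {S R : G.V} {n : ℕ} {a : Equiv.Perm (Fin n ⊕ G.E)} (ha : Sys G S R n a) (i : Fin n) :
    ∀ (N : ℕ) (B : ℕ) (_ : ∀ v, r v ≤ B) (e : G.E), B - r (G.src e) ≤ N → From a i e →
      ∃ p : List G.E, (e :: p).IsChain (fun f e => a (inr f) = inr e ∧ f ≠ e) ∧
        (∀ x ∈ e :: p, From a i x) ∧ ∀ x ∈ (e :: p).getLast?, G.dst x = R := by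
  intro N B hB
  induction N with
  | zero =>
    intro e he
    have := hr e
    have := hB (G.dst e)
    omega
  | succ N ih =>
    intro e he hF
    rcases hae : a (inr e) with k | e'
    · refine ⟨[], by simp, by simpa using hF, ?_⟩
      simpa using ha.en _ _ hae
    · have hne : e ≠ e' := by
        rintro rfl
        cases hF with
        | first h => exact absurd (a.injective (h.trans hae.symm)) (by simp)
        | next _ h h' => exact h' (inr_injective (a.injective (h.trans hae.symm)))
      have hd : G.dst e = G.src e' := (ha.nx _ _ hae).resolve_left (Ne.symm hne)
      have := hr e
      have := hB (G.dst e)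
      obtain ⟨p, p1, p2, p3⟩ := ih e' (by rw [← hd]; omega) (hF.next hae hne)
      refine ⟨e' :: p, ?_, ?_, by simpa using p3⟩
      · rw [List.isChain_cons_cons]
        exact ⟨⟨hae, hne⟩, p1⟩
      · intro x hx
        rcases List.mem_cons.1 hx with rfl | hx
        · exact hF
        · exact p2 x hx

theorem menger_of_sys {G : MultiDigraph} {r : G.V → ℕ} (hr : ∀ e, r (G.src e) < r (G.dst e))
    {S R : G.V} {n : ℕ} {a : Equiv.Perm (Fin n ⊕ G.E)} (ha : Sys G S R n a) :
    ∃ α : Fin n → List G.E, G.MengerSystem S R n α ∧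
      ∀ i f e, [f, e] <:+: α i → a (inr f) = inr e ∧ f ≠ e := by
  have := G.fintV
  obtain ⟨B, hB⟩ : ∃ B, ∀ v, r v ≤ B :=
    ⟨Finset.univ.sup r, fun v => Finset.le_sup (Finset.mem_univ v)⟩
  have key : ∀ i : Fin n, ∃ p : List G.E, G.IsPathFrom S R p ∧
      p.IsChain (fun f e => a (inr f) = inr e ∧ f ≠ e) ∧ ∀ x ∈ p, From a i x := by
    intro i
    obtain ⟨e, he, hs⟩ := ha.st i
    obtain ⟨p, p1, p2, p3⟩ := walk hr ha i _ B hB e le_rfl (From.first he)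
    refine ⟨e :: p, ⟨by simp, ?_, by simpa using hs, p3⟩, p1, p2⟩
    have : (e :: p).IsChain (fun e f => G.dst e = G.src f) :=
      p1.imp fun x y h => (ha.nx _ _ h.1).resolve_left (Ne.symm h.2)
    exact this
  choose α h1 h2 h3 using key
  refine ⟨α, ⟨h1, ?_⟩, ?_⟩
  · intro i j hij e he he'
    exact hij ((h3 i e he).unique (h3 j e he'))
  · intro i f e h
    have := (h2 i).infix h
    simpa using this

end MS
namespace MS

open MultiDigraph Sum Relation

theorem used_ge {G : MultiDigraph} {r : G.V → ℕ} (hr : ∀ e, r (G.src e) < r (G.dst e))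
    {S R : G.V} {n : ℕ} {a : Equiv.Perm (Fin n ⊕ G.E)} (ha : Sys G S R n a) :
    ∀ (N : ℕ) (e : G.E), r (G.src e) ≤ N → a (inr e) ≠ inr e → r S ≤ r (G.src e) := by
  intro N
  induction N using Nat.strong_induction_on with
  | _ N ih =>
    intro e hN he
    obtain ⟨x, hx⟩ := a.surjective (inr e)
    rcases x with i | f
    · obtain ⟨e', h1, h2⟩ := ha.st i
      rw [hx] at h1
      cases h1
      rw [h2]
    · have hfe : e ≠ f := by rintro rfl; exact he hx
      have hd := (ha.nx _ _ hx).resolve_left hfe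
      have h1 := hr f
      rw [hd] at h1
      have := ih (r (G.src f)) (by omega) f le_rfl (by
        rw [hx]; intro h; exact hfe (inr_injective h))
      omega

theorem no_pred {G : MultiDigraph} {r : G.V → ℕ} (hr : ∀ e, r (G.src e) < r (G.dst e))
    {S R : G.V} {n : ℕ} {a : Equiv.Perm (Fin n ⊕ G.E)} (ha : Sys G S R n a) {f e : G.E}
    (h : a (inr f) = inr e) (hfe : f ≠ e) : G.src e ≠ S := by
  have hd := (ha.nx _ _ h).resolve_left hfe.symm
  have h1 := hr f
  have := used_ge hr ha _ f le_rfl (by rw [h]; intro h; exact hfe (inr_injective h).symm)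
  intro hS
  rw [hd, hS] at h1
  omega

/-- an edge not at the source is unused or has a predecessor -/
theorem pred_cases {G : MultiDigraph}
    {S R : G.V} {n : ℕ} {a : Equiv.Perm (Fin n ⊕ G.E)} (ha : Sys G S R n a) {e : G.E}
    (he : G.src e ≠ S) : a (inr e) = inr e ∨ ∃ f, f ≠ e ∧ a (inr f) = inr e := by
  obtain ⟨x, hx⟩ := a.surjective (inr e)
  rcases x with i | f
  · obtain ⟨e', h1, h2⟩ := ha.st i
    rw [hx] at h1
    cases h1
    exact absurd h2 he
  · by_cases hf : f = e
    · subst hf; exact Or.inl hx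
    · exact Or.inr ⟨f, hf, hx⟩

structure Inv {E : Type} (a b : Equiv.Perm (Fin 4 ⊕ E)) (P : Finset E) (A B : Mx)
    (y z : Fin 4 → E) : Prop where
  yP : ∀ i, y i ∈ P
  zP : ∀ j, z j ∈ P
  yt : ∀ f ∈ P, ∀ e, e ∉ P → a (inr f) = inr e → ∃ i, y i = f
  zt : ∀ f ∈ P, ∀ e, e ∉ P → b (inr f) = inr e → ∃ i, z i = f
  hA : ∀ i j, A i j = true → ReflTransGen (Res a b) (inr (y i)) (inr (z j))
  hB : ∀ i j, B i j = true → ReflTransGen (Res b a) (inr (z j)) (inr (y i))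
  cA : ∀ i j, y i = z j → ∀ i', i' ≠ i → A i' j = false
  cB : ∀ i j, y i = z j → ∀ j', j' ≠ j → B i j' = false

theorem tip_upd {E : Type} [DecidableEq E] {a : Equiv.Perm (Fin 4 ⊕ E)} {P : Finset E} {y : Fin 4 → E}
    (yt : ∀ f ∈ P, ∀ e, e ∉ P → a (inr f) = inr e → ∃ i, y i = f) {e : E} {i : Fin 4}
    (h : a (inr (y i)) = inr e) :
    ∀ f ∈ insert e P, ∀ e', e' ∉ insert e P → a (inr f) = inr e' →
      ∃ k, Function.update y i e k = f := by
  intro f hf e' he' hfe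
  rw [Finset.mem_insert, not_or] at he'
  rcases Finset.mem_insert.1 hf with rfl | hf
  · exact ⟨i, by simp⟩
  · obtain ⟨k, rfl⟩ := yt f hf e' he'.2 hfe
    have hki : k ≠ i := by
      rintro rfl
      rw [h] at hfe
      exact he'.1 (inr_injective hfe).symm
    exact ⟨k, by simp [hki]⟩

theorem tip_same {E : Type} [DecidableEq E] {a : Equiv.Perm (Fin 4 ⊕ E)} {P : Finset E} {y : Fin 4 → E}
    (yt : ∀ f ∈ P, ∀ e, e ∉ P → a (inr f) = inr e → ∃ i, y i = f) {e : E}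
    (h : a (inr e) = inr e) :
    ∀ f ∈ insert e P, ∀ e', e' ∉ insert e P → a (inr f) = inr e' → ∃ k, y k = f := by
  intro f hf e' he' hfe
  rw [Finset.mem_insert, not_or] at he'
  rcases Finset.mem_insert.1 hf with rfl | hf
  · rw [h] at hfe
    exact absurd (inr_injective hfe).symm he'.1
  · exact yt f hf e' he'.2 hfe

theorem upd_mem {E : Type} [DecidableEq E] {P : Finset E} {y : Fin 4 → E} (h : ∀ i, y i ∈ P) (e : E)
    (i : Fin 4) : ∀ k, Function.update y i e k ∈ insert e P := by
  intro k
  by_cases hk : k = i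
  · subst hk; simp
  · simp [hk, h k]

theorem res_back {ι E : Type} {a : Equiv.Perm (ι ⊕ E)} (b : Equiv.Perm (ι ⊕ E)) {x : ι ⊕ E} {e : E}
    (h : a x = inr e) : Res a b (inr e) x := Or.inl ⟨e, rfl, h⟩

theorem res_fwd {ι E : Type} {a b : Equiv.Perm (ι ⊕ E)} {x y : ι ⊕ E} {e : E}
    (h : b x = inr e) (h' : a y = inr e) : Res a b x y := Or.inr ⟨e, h', h⟩

theorem inv_swap {E : Type} {a b : Equiv.Perm (Fin 4 ⊕ E)} {P : Finset E} {A B : Mx}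
    {y z : Fin 4 → E} (h : Inv a b P A B y z) :
    Inv b a P (fun i j => B j i) (fun i j => A j i) z y :=
  ⟨h.zP, h.yP, h.zt, h.yt, fun i j => h.hB j i, fun i j => h.hA j i,
    fun i j e => h.cB j i e.symm, fun i j e => h.cA j i e.symm⟩

theorem inv_none {E : Type} [DecidableEq E] {a b : Equiv.Perm (Fin 4 ⊕ E)} {P : Finset E} {A B : Mx}
    {y z : Fin 4 → E} (h : Inv a b P A B y z) {e : E} (h1 : a (inr e) = inr e)
    (h2 : b (inr e) = inr e) : Inv a b (insert e P) A B y z :=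
  ⟨fun i => Finset.mem_insert_of_mem (h.yP i), fun i => Finset.mem_insert_of_mem (h.zP i),
    tip_same h.yt h1, tip_same h.zt h2, h.hA, h.hB, h.cA, h.cB⟩

theorem inv_left {E : Type} [DecidableEq E] {a b : Equiv.Perm (Fin 4 ⊕ E)} {P : Finset E} {A B : Mx}
    {y z : Fin 4 → E} (h : Inv a b P A B y z) {e : E} (heP : e ∉ P) {i : Fin 4}
    (h1 : a (inr (y i)) = inr e) (h2 : b (inr e) = inr e) :
    Inv a b (insert e P) A B (Function.update y i e) z := by
  have hz : ∀ j, e ≠ z j := fun j hj => heP (hj ▸ h.zP j)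
  refine ⟨upd_mem h.yP e i, fun i => Finset.mem_insert_of_mem (h.zP i),
    tip_upd h.yt h1, tip_same h.zt h2, ?_, ?_, ?_, ?_⟩
  · intro k j hk
    by_cases hki : k = i
    · subst hki
      rw [Function.update_self]
      exact ReflTransGen.head (res_back b h1) (h.hA _ _ hk)
    · rw [Function.update_of_ne hki]
      exact h.hA _ _ hk
  · intro k j hk
    by_cases hki : k = i
    · subst hki
      rw [Function.update_self]
      exact (h.hB _ _ hk).tail (res_fwd h1 h2)
    · rw [Function.update_of_ne hki]
      exact h.hB _ _ hk
  · intro k j hk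
    by_cases hki : k = i
    · subst hki
      rw [Function.update_self] at hk
      exact absurd hk (hz j)
    · rw [Function.update_of_ne hki] at hk
      exact h.cA _ _ hk
  · intro k j hk
    by_cases hki : k = i
    · subst hki
      rw [Function.update_self] at hk
      exact absurd hk (hz j)
    · rw [Function.update_of_ne hki] at hk
      exact h.cB _ _ hk

theorem upd_eq {E : Type} {P : Finset E} {y z : Fin 4 → E} (hy : ∀ i, y i ∈ P) (hz : ∀ i, z i ∈ P)
    {e : E} (heP : e ∉ P) {i j k l : Fin 4}
    (h : Function.update y i e k = Function.update z j e l) :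
    (k = i ∧ l = j) ∨ (k ≠ i ∧ l ≠ j ∧ y k = z l) := by
  by_cases hk : k = i <;> by_cases hl : l = j
  · exact Or.inl ⟨hk, hl⟩
  · subst hk
    rw [Function.update_self, Function.update_of_ne hl] at h
    exact absurd (h ▸ hz l) heP
  · subst hl
    rw [Function.update_self, Function.update_of_ne hk] at h
    exact absurd (h ▸ hy k) heP
  · rw [Function.update_of_ne hl, Function.update_of_ne hk] at h
    exact Or.inr ⟨hk, hl, h⟩

/-- both paths continue along the same edge -/
theorem inv_same {E : Type} [DecidableEq E] {a b : Equiv.Perm (Fin 4 ⊕ E)} {P : Finset E} {A B : Mx}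
    {y z : Fin 4 → E} (h : Inv a b P A B y z) {e : E} (heP : e ∉ P) {i j : Fin 4}
    (h1 : a (inr (y i)) = inr e) (h2 : b (inr (z j)) = inr e) (hyz : y i = z j) :
    Inv a b (insert e P) A B (Function.update y i e) (Function.update z j e) := by
  refine ⟨upd_mem h.yP e i, upd_mem h.zP e j, tip_upd h.yt h1, tip_upd h.zt h2, ?_, ?_, ?_, ?_⟩
  · intro k l hkl
    by_cases hl : l = j
    · subst hl
      by_cases hk : k = i
      · subst hk
        rw [Function.update_self, Function.update_self]
      · rw [h.cA _ _ hyz k hk] at hkl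
        cases hkl
    · rw [Function.update_of_ne hl]
      by_cases hk : k = i
      · subst hk
        rw [Function.update_self]
        exact ReflTransGen.head (res_back b h1) (h.hA _ _ hkl)
      · rw [Function.update_of_ne hk]
        exact h.hA _ _ hkl
  · intro k l hkl
    by_cases hk : k = i
    · subst hk
      by_cases hl : l = j
      · subst hl
        rw [Function.update_self, Function.update_self]
      · rw [h.cB _ _ hyz l hl] at hkl
        cases hkl
    · rw [Function.update_of_ne hk]
      by_cases hl : l = j
      · subst hl
        rw [Function.update_self]
        exact ReflTransGen.head (res_back a h2) (h.hB _ _ hkl)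
      · rw [Function.update_of_ne hl]
        exact h.hB _ _ hkl
  · intro k l hkl k' hk'
    rcases upd_eq h.yP h.zP heP hkl with ⟨rfl, rfl⟩ | ⟨-, -, h3⟩
    · exact h.cA _ _ hyz k' hk'
    · exact h.cA _ _ h3 k' hk'
  · intro k l hkl k' hk'
    rcases upd_eq h.yP h.zP heP hkl with ⟨rfl, rfl⟩ | ⟨-, -, h3⟩
    · exact h.cB _ _ hyz k' hk'
    · exact h.cB _ _ h3 k' hk'

/-- a merging -/
theorem inv_merge {E : Type} [DecidableEq E] {a b : Equiv.Perm (Fin 4 ⊕ E)} {P : Finset E} {A B : Mx}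
    {y z : Fin 4 → E} (h : Inv a b P A B y z) {e : E} (heP : e ∉ P) {i j : Fin 4}
    (h1 : a (inr (y i)) = inr e) (h2 : b (inr (z j)) = inr e) :
    Inv a b (insert e P) (stA A i j) (stB B i j) (Function.update y i e)
      (Function.update z j e) := by
  refine ⟨upd_mem h.yP e i, upd_mem h.zP e j, tip_upd h.yt h1, tip_upd h.zt h2, ?_, ?_, ?_, ?_⟩
  · intro k l hkl
    by_cases hk : k = i
    · subst hk
      by_cases hl : l = j
      · subst hl
        rw [Function.update_self, Function.update_self]
      · rw [Function.update_self, Function.update_of_ne hl]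
        simp only [stA, if_true, if_neg hl] at hkl
        exact ReflTransGen.head (res_back b h1) (h.hA _ _ hkl)
    · by_cases hl : l = j
      · simp [stA, hk, hl] at hkl
      · rw [Function.update_of_ne hk, Function.update_of_ne hl]
        simp only [stA, if_neg hk, if_neg hl, Bool.or_eq_true, Bool.and_eq_true] at hkl
        rcases hkl with hkl | ⟨hkj, hil⟩
        · exact h.hA _ _ hkl
        · exact ((h.hA _ _ hkj).tail (res_fwd h2 h1)).trans (h.hA _ _ hil)
  · intro k l hkl
    by_cases hl : l = j
    · subst hl
      by_cases hk : k = i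
      · subst hk
        rw [Function.update_self, Function.update_self]
      · rw [Function.update_self, Function.update_of_ne hk]
        simp only [stB, if_true, if_neg hk] at hkl
        exact ReflTransGen.head (res_back a h2) (h.hB _ _ hkl)
    · by_cases hk : k = i
      · simp [stB, hk, hl] at hkl
      · rw [Function.update_of_ne hk, Function.update_of_ne hl]
        simp only [stB, if_neg hk, if_neg hl, Bool.or_eq_true, Bool.and_eq_true] at hkl
        rcases hkl with hkl | ⟨hkj, hil⟩
        · exact h.hB _ _ hkl
        · exact ((h.hB _ _ hkj).tail (res_fwd h1 h2)).trans (h.hB _ _ hil)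
  · intro k l hkl k' hk'
    rcases upd_eq h.yP h.zP heP hkl with ⟨rfl, rfl⟩ | ⟨h4, h5, h3⟩
    · simp [stA, hk']
    · have := h.cA _ _ h3 k' hk'
      have := h.cA _ _ h3 i h4.symm
      by_cases hki : k' = i <;> simp [stA, *]
  · intro k l hkl k' hk'
    rcases upd_eq h.yP h.zP heP hkl with ⟨rfl, rfl⟩ | ⟨h4, h5, h3⟩
    · simp [stB, hk']
    · have := h.cB _ _ h3 k' hk'
      have := h.cB _ _ h3 j h5.symm
      by_cases hki : k' = j <;> simp [stB, *]

open Classical in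
theorem main_inv {G : MultiDigraph} {r : G.V → ℕ} (hr : ∀ e, r (G.src e) < r (G.dst e))
    {S R R' : G.V} {a b : Equiv.Perm (Fin 4 ⊕ G.E)} (ha : Sys G S R 4 a) (hb : Sys G S R' 4 b)
    (hre : ∀ i j, a (inl i) = b (inl j) → i = j)
    (hmA : ∀ e f g, f ≠ g → a (inr f) = inr e → b (inr g) = inr e → Mg a b e →
      ¬ ReflTransGen (Res a b) (inr f) (inr g))
    (hmB : ∀ e f g, f ≠ g → a (inr f) = inr e → b (inr g) = inr e → Mg a b e →
      ¬ ReflTransGen (Res b a) (inr g) (inr f)) :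
    ∀ (N : ℕ) (P : Finset G.E), P.card = N → (∀ e, G.src e = S → e ∈ P) →
      (∀ e ∈ P, ∀ f, f ≠ e → a (inr f) = inr e → f ∈ P) →
      (∀ e ∈ P, ∀ f, f ≠ e → b (inr f) = inr e → f ∈ P) →
      ∃ A B y z, Run (P.filter (Mg a b)).card A B ∧ Inv a b P A B y z := by
  intro N
  induction N with
  | zero =>
    intro P hP hS
    obtain ⟨e, -, he⟩ := ha.st 0
    have := hS e he
    rw [Finset.card_eq_zero] at hP
    simp [hP] at this
  | succ N ih =>
    intro P hP hS hca hcb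
    by_cases hex : ∃ e ∈ P, G.src e ≠ S
    · obtain ⟨e1, he1, he1'⟩ := hex
      obtain ⟨e, he, hmax⟩ := Finset.exists_max_image (P.filter fun e => G.src e ≠ S)
        (fun e => r (G.src e)) ⟨e1, by simp [he1, he1']⟩
      simp only [Finset.mem_filter] at he hmax
      obtain ⟨heP, heS⟩ := he
      have hcl : ∀ (R : G.V) (a : Equiv.Perm (Fin 4 ⊕ G.E)), Sys G S R 4 a →
          (∀ e ∈ P, ∀ f, f ≠ e → a (inr f) = inr e → f ∈ P) →
          ∀ e' ∈ P.erase e, ∀ f, f ≠ e' → a (inr f) = inr e' → f ∈ P.erase e := by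
        intro R a ha hca e' he' f hf haf
        have he'' := Finset.mem_of_mem_erase he'
        refine Finset.mem_erase.2 ⟨?_, hca e' he'' f hf haf⟩
        rintro rfl
        have h1 := hmax e' ⟨he'', no_pred hr ha haf hf⟩
        rw [← (ha.nx _ _ haf).resolve_left hf.symm] at h1
        have := hr f
        omega
      obtain ⟨A, B, y, z, hrun, hinv⟩ := ih (P.erase e) (by rw [Finset.card_erase_of_mem heP, hP]; rfl)
        (fun e' he' => Finset.mem_erase.2 ⟨by rintro rfl; exact heS he', hS e' he'⟩)
        (hcl R a ha hca) (hcl R' b hb hcb)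
      have hPe : P = insert e (P.erase e) := (Finset.insert_erase heP).symm
      have hne : e ∉ P.erase e := by simp
      have hfil : ¬ Mg a b e → P.filter (Mg a b) = (P.erase e).filter (Mg a b) := by
        intro h
        conv_lhs => rw [hPe]
        rw [Finset.filter_insert, if_neg h]
      generalize hQ : P.erase e = Q at *
      rcases pred_cases ha heS with h1 | ⟨f, hf, h1⟩
      · have hM : ¬ Mg a b e := by
          rintro ⟨f', g', q1, q2, q3, q4, q5⟩
          exact q2 (inr_injective (a.injective (q4.trans h1.symm)))
        rw [hfil hM, hPe]
        rcases pred_cases hb heS with h2 | ⟨g, hg, h2⟩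
        · exact ⟨A, B, y, z, hrun, inv_none hinv h1 h2⟩
        · have hgQ : g ∈ Q := by
            rw [← hQ]; exact Finset.mem_erase.2 ⟨hg, hcb e heP g hg h2⟩
          obtain ⟨j, rfl⟩ := hinv.zt g hgQ e hne h2
          exact ⟨A, B, _, _, hrun, inv_swap (inv_left (inv_swap hinv) hne h2 h1)⟩
      · have hfQ : f ∈ Q := by
          rw [← hQ]; exact Finset.mem_erase.2 ⟨hf, hca e heP f hf h1⟩
        obtain ⟨i, rfl⟩ := hinv.yt f hfQ e hne h1
        rcases pred_cases hb heS with h2 | ⟨g, hg, h2⟩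
        · have hM : ¬ Mg a b e := by
            rintro ⟨f', g', q1, q2, q3, q4, q5⟩
            exact q3 (inr_injective (b.injective (q5.trans h2.symm)))
          rw [hfil hM, hPe]
          exact ⟨A, B, _, _, hrun, inv_left hinv hne h1 h2⟩
        · have hgQ : g ∈ Q := by
            rw [← hQ]; exact Finset.mem_erase.2 ⟨hg, hcb e heP g hg h2⟩
          obtain ⟨j, rfl⟩ := hinv.zt g hgQ e hne h2
          by_cases hyz : y i = z j
          · have hM : ¬ Mg a b e := by
              rintro ⟨f', g', q1, q2, q3, q4, q5⟩
              have := inr_injective (b.injective (q5.trans h2.symm))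
              have := inr_injective (a.injective (q4.trans h1.symm))
              subst f' g'
              exact q1 hyz
            rw [hfil hM, hPe]
            exact ⟨A, B, _, _, hrun, inv_same hinv hne h1 h2 hyz⟩
          · have hM : Mg a b e := ⟨_, _, hyz, hf, hg, h1, h2⟩
            have hcard : (P.filter (Mg a b)).card = (Q.filter (Mg a b)).card + 1 := by
              rw [hPe, Finset.filter_insert, if_pos hM, Finset.card_insert_of_notMem]
              simp [hne]
            rw [hcard, hPe]
            refine ⟨_, _, _, _, Run.step i j hrun ?_ ?_, inv_merge hinv hne h1 h2⟩
            · by_contra hc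
              rw [Bool.not_eq_false] at hc
              exact hmA e _ _ hyz h1 h2 hM (hinv.hA _ _ hc)
            · by_contra hc
              rw [Bool.not_eq_false] at hc
              exact hmB e _ _ hyz h1 h2 hM (hinv.hB _ _ hc)
    · push Not at hex
      choose y hy hyS using ha.st
      choose z hz hzS using hb.st
      have hfil : P.filter (Mg a b) = ∅ := by
        rw [Finset.filter_eq_empty_iff]
        rintro e he ⟨f', g', q1, q2, q3, q4, q5⟩
        exact no_pred hr ha q4 q2 (hex e he)
      -- one direction of reachability at the start
      have start : ∀ (R R' : G.V) (a b : Equiv.Perm (Fin 4 ⊕ G.E)) (y z : Fin 4 → G.E),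
          Sys G S R 4 a → Sys G S R' 4 b → (∀ i, a (inl i) = inr (y i)) →
          (∀ i, b (inl i) = inr (z i)) → (∀ i, G.src (z i) = S) →
          (∀ i j, a (inl i) = b (inl j) → i = j) →
          ∀ i, ReflTransGen (Res a b) (inr (y i)) (inr (z i)) := by
        intro R R' a b y z ha hb hy hz hzS hre i
        by_cases hyz : y i = z i
        · rw [hyz]
        · have h1 : a (inr (z i)) = inr (z i) := by
            obtain ⟨x, hx⟩ := a.surjective (inr (z i))
            rcases x with k | f
            · have := hre k i (by rw [hx, hz])
              subst this
              rw [hy] at hx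
              exact absurd (inr_injective hx) hyz
            · by_cases hf : f = z i
              · subst hf; exact hx
              · exact absurd (hzS i) (no_pred hr ha hx hf)
          exact (ReflTransGen.single (res_back b (hy i))).tail (res_fwd (hz i) h1)
      refine ⟨idM, idM, y, z, ?_, ?_⟩
      · rw [hfil]; exact Run.init
      · have tip : ∀ (R : G.V) (a : Equiv.Perm (Fin 4 ⊕ G.E)) (y : Fin 4 → G.E),
            Sys G S R 4 a → (∀ i, a (inl i) = inr (y i)) →
            ∀ f ∈ P, ∀ e, e ∉ P → a (inr f) = inr e → ∃ i, y i = f := by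
          intro R a y ha hy f hf e he hfe
          obtain ⟨x, hx⟩ := a.surjective (inr f)
          rcases x with k | f'
          · rw [hy] at hx
            exact ⟨k, inr_injective hx⟩
          · by_cases hf' : f' = f
            · subst hf'
              rw [hx] at hfe
              exact absurd (inr_injective hfe ▸ hf) he
            · exact absurd (hex f hf) (no_pred hr ha hx hf')
        refine ⟨fun i => hS _ (hyS i), fun i => hS _ (hzS i), tip R a y ha hy, tip R' b z hb hz,
          ?_, ?_, ?_, ?_⟩
        · intro i j hij
          have : i = j := by simpa [idM] using hij
          subst this
          exact start R R' a b y z ha hb hy hz hzS hre i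
        · intro i j hij
          have : i = j := by simpa [idM] using hij
          subst this
          exact start R' R b a z y hb ha hz hy hyS (fun i j h => (hre j i h.symm).symm) i
        · intro i j hij k hk
          have : i = j := hre i j (by rw [hy, hz, hij])
          subst this
          simpa [idM] using hk
        · intro i j hij k hk
          have : i = j := hre i j (by rw [hy, hz, hij])
          subst this
          simpa [idM] using hk.symm

theorem reindex {G : MultiDigraph} {S R : G.V} {a b : Equiv.Perm (Fin 4 ⊕ G.E)}
    (hb : Sys G S R 4 b) :
    ∃ b' : Equiv.Perm (Fin 4 ⊕ G.E), Sys G S R 4 b' ∧ (∀ e, b' (inr e) = b (inr e)) ∧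
      ∀ i j, a (inl i) = b' (inl j) → i = j := by
  classical
  let p : Fin 4 → Prop := fun j => ∃ i, a (inl i) = b (inl j)
  let q : Fin 4 → Prop := fun i => ∃ j, a (inl i) = b (inl j)
  have hf : ∀ x : {i // q i}, ∃ y : {j // p j}, a (inl x.1) = b (inl y.1) := by
    rintro ⟨i, j, h⟩
    exact ⟨⟨j, i, h⟩, h⟩
  choose f hf using hf
  have hbij : Function.Bijective f := by
    constructor
    · intro x y hxy
      have h1 := hf x
      rw [hxy, ← hf y] at h1
      exact Subtype.ext (inl_injective (a.injective h1))
    · rintro ⟨j, i, h⟩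
      refine ⟨⟨i, j, h⟩, ?_⟩
      have h1 := h.symm.trans (hf ⟨i, j, h⟩)
      exact Subtype.ext (inl_injective (b.injective h1)).symm
  let ρ : Equiv.Perm (Fin 4) := (Equiv.ofBijective f hbij).extendSubtype
  refine ⟨(Equiv.sumCongr ρ (Equiv.refl _)).trans b, ⟨?_, ?_, ?_⟩, ?_, ?_⟩
  · intro i; exact hb.st (ρ i)
  · intro e e' h; exact hb.nx e e' h
  · intro e e' h; exact hb.en e e' h
  · intro e; rfl
  · intro i j h
    have h' : a (inl i) = b (inl (ρ j)) := h
    have h1 : ρ i = f ⟨i, ρ j, h'⟩ := Equiv.extendSubtype_apply_of_mem (Equiv.ofBijective f hbij) i ⟨ρ j, h'⟩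
    have h2 := hf ⟨i, ρ j, h'⟩
    rw [← h1] at h2
    simp only at h2
    rw [h'] at h2
    exact (ρ.injective (inl_injective (b.injective h2))).symm

theorem upper : MstarAtMost ![4, 4] 9 := by
  classical
  intro G S R hG hS
  obtain ⟨hac, -, hmc⟩ := hG
  have := G.fintE
  obtain ⟨r, hr⟩ := exists_rank G hac
  obtain ⟨⟨α, hα⟩, -⟩ := hmc 0
  obtain ⟨⟨β, hβ⟩, -⟩ := hmc 1
  rw [hS 1 0] at hβ
  obtain ⟨a0, ha0⟩ := sys_of_menger hr hα
  obtain ⟨b0, hb0⟩ := sys_of_menger hr hβ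
  change Equiv.Perm (Fin 4 ⊕ G.E) at a0 b0
  change Sys G (S 0) (R 0) 4 a0 at ha0
  change Sys G (S 0) (R 1) 4 b0 at hb0
  let Q : ℕ → Prop := fun m => ∃ a b, Sys G (S 0) (R 0) 4 a ∧ Sys G (S 0) (R 1) 4 b ∧
    (Finset.univ.filter (Mg a b)).card = m
  have hQ : ∃ m, Q m := ⟨_, a0, b0, ha0, hb0, rfl⟩
  obtain ⟨a, b1, ha, hb1, hcard1⟩ := Nat.find_spec hQ
  obtain ⟨b, hb, hbb, hre⟩ := reindex (a := a) hb1
  have hMM : ∀ e, Mg a b1 e ↔ Mg a b e := by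
    intro e
    simp only [Mg, hbb]
  have hcard : (Finset.univ.filter (Mg a b)).card = Nat.find hQ := by
    rw [← hcard1]
    congr 1
    ext e
    simp [hMM]
  have hmin : ∀ a' b', Sys G (S 0) (R 0) 4 a' → Sys G (S 0) (R 1) 4 b' →
      (∀ e, Mg a' b' e → Mg a b e) → ∀ e, Mg a b e → Mg a' b' e := by
    intro a' b' ha' hb' hsub e he
    by_contra hc
    refine Nat.find_min hQ ?_ ⟨a', b', ha', hb', rfl⟩
    rw [← hcard]
    apply Finset.card_lt_card
    rw [Finset.ssubset_iff_of_subset]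
    · exact ⟨e, by simpa using he, by simpa using hc⟩
    · intro x hx
      simpa using hsub x (by simpa using hx)
  obtain ⟨A, B, y, z, hrun, -⟩ := main_inv hr ha hb hre
    (by
      intro e f g hfg haf hbg hM hp
      obtain ⟨a', ha', h1, h2⟩ := reroute ha hb hfg haf hbg hp
      exact h2 (hmin a' b ha' hb h1 e hM))
    (by
      intro e f g hfg haf hbg hM hp
      obtain ⟨b', hb', h1, h2⟩ := reroute hb ha hfg.symm hbg haf hp
      exact h2 (hmin a b' ha hb' (fun e h => (h1 e h.symm).symm) e hM).symm)
    _ Finset.univ rfl (by simp) (by simp) (by simp)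
  have h9 := run_le hrun
  obtain ⟨α', hα', hα''⟩ := menger_of_sys hr ha
  obtain ⟨β', hβ', hβ''⟩ := menger_of_sys hr hb
  refine ⟨fun i => match i with | 0 => α' | 1 => β', ?_, ?_⟩
  · intro i
    match i with
    | 0 => exact hα'
    | 1 => rw [hS 1 0]; exact hβ'
  · refine le_trans ?_ h9
    rw [mergingCount, ← Set.ncard_coe_finset]
    apply Set.ncard_le_ncard _ (Finset.finite_toSet _)
    rintro e ⟨i, j, hij, k, l, f, g, hfg, h1, h2⟩
    simp only [Finset.coe_filter, Finset.mem_univ, true_and, Set.mem_ofPred_eq]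
    match i, j with
    | 0, 0 => exact absurd rfl hij
    | 1, 1 => exact absurd rfl hij
    | 0, 1 =>
      have h1 := hα'' _ _ _ h1
      have h2 := hβ'' _ _ _ h2
      exact ⟨f, g, hfg, h1.2, h2.2, h1.1, h2.1⟩
    | 1, 0 =>
      have h1 := hβ'' _ _ _ h1
      have h2 := hα'' _ _ _ h2
      exact ⟨g, f, hfg.symm, h2.2, h1.2, h2.1, h1.1⟩

end MS
namespace MS

open MultiDigraph

def xsrc : Fin 39 → Fin 25 := ![0, 0, 0, 0, 5, 7, 9, 11, 13, 15, 17, 19, 21, 1, 2, 3, 4, 6, 8, 10, 12, 14, 16, 18, 20, 22, 1, 2, 3, 4, 6, 8, 10, 12, 14, 16, 18, 20, 22]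

def xdst : Fin 39 → Fin 25 := ![1, 2, 3, 4, 6, 8, 10, 12, 14, 16, 18, 20, 22, 5, 13, 11, 23, 7, 9, 23, 19, 15, 17, 23, 21, 23, 24, 5, 7, 9, 15, 17, 11, 13, 24, 21, 19, 24, 24]

def xpa : Fin 4 → List (Fin 39) := ![[0, 13, 4, 17, 5, 18, 6, 19], [1, 14, 8, 21, 9, 22, 10, 23], [2, 15, 7, 20, 11, 24, 12, 25], [3, 16]]

def xpb : Fin 4 → List (Fin 39) := ![[0, 26], [1, 27, 4, 30, 9, 35, 12, 38], [2, 28, 5, 31, 10, 36, 11, 37], [3, 29, 6, 32, 7, 33, 8, 34]]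

def xfa : Fin 9 → Fin 39 := ![13, 17, 18, 15, 14, 21, 22, 20, 24]

def xfb : Fin 9 → Fin 39 := ![27, 28, 29, 32, 33, 30, 31, 36, 35]

def xua : Fin 9 → ℕ := ![16777219, 16834663, 20707823, 16834799, 16777255, 16801831, 20576495, 16840943, 18413807]

def xub : Fin 9 → ℕ := ![9322397, 8392217, 8388625, 8390161, 9314201, 9322493, 8392601, 8785817, 9420797]

def xe : Fin 9 → Fin 39 := ![4, 5, 6, 7, 8, 9, 10, 11, 12]

def XG : MultiDigraph := ⟨Fin 25, Fin 39, inferInstance, inferInstance, xsrc, xdst⟩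

theorem path_rank {G : MultiDigraph} {r : G.V → ℕ} (hr : ∀ e, r (G.src e) < r (G.dst e)) (v : G.V) :
    ∀ (p : List G.E) (u : G.V), G.IsPathFrom u v p → r u < r v := by
  intro p
  induction p with
  | nil => intro u h; exact absurd rfl h.1
  | cons e p ih =>
    intro u ⟨_, h2, h3, h4⟩
    have h2' : List.IsChain (fun e f => G.dst e = G.src f) (e :: p) := h2
    simp only [List.head?_cons, Option.mem_def, Option.some.injEq, forall_eq'] at h3
    subst h3
    cases p with
    | nil =>
      simp at h4
      rw [← h4]
      exact hr e
    | cons f p =>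
      rw [List.isChain_cons_cons] at h2'
      exact (hr e).trans (ih (G.dst e) ⟨by simp, h2'.2, by simp [h2'.1], by simpa using h4⟩)

theorem crossing {G : MultiDigraph} (U : G.V → Prop) (v : G.V) (hv : ¬ U v) :
    ∀ (p : List G.E) (u : G.V), G.IsPathFrom u v p → U u →
      ∃ e ∈ p, U (G.src e) ∧ ¬ U (G.dst e) := by
  intro p
  induction p with
  | nil => intro u h; exact absurd rfl h.1
  | cons e p ih =>
    intro u ⟨_, h2, h3, h4⟩ hu
    have h2' : List.IsChain (fun e f => G.dst e = G.src f) (e :: p) := h2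
    simp only [List.head?_cons, Option.mem_def, Option.some.injEq, forall_eq'] at h3
    subst h3
    by_cases hd : U (G.dst e)
    · cases p with
      | nil =>
        simp at h4
        rw [h4] at hd
        exact absurd hd hv
      | cons f p =>
        rw [List.isChain_cons_cons] at h2'
        obtain ⟨x, hx, hx'⟩ :=
          ih (G.dst e) ⟨by simp, h2'.2, by simp [h2'.1], by simpa using h4⟩ hd
        exact ⟨x, List.mem_cons_of_mem _ hx, hx'⟩
    · exact ⟨e, by simp, hu, hd⟩

theorem cut_inj {G : MultiDigraph} (U : G.V → Prop) (u v : G.V) (hu : U u) (hv : ¬ U v)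
    (C : Finset G.E) (hC : ∀ e, U (G.src e) → ¬ U (G.dst e) → e ∈ C) {n : ℕ}
    {α : Fin n → List G.E} (h : G.MengerSystem u v n α) :
    n ≤ C.card ∧ (C.card ≤ n → ∀ e ∈ C, ∃ i, e ∈ α i) := by
  classical
  have h1 := fun i => crossing U v hv (α i) u (h.1 i) hu
  choose x hx hx1 hx2 using h1
  have hinj : Function.Injective x := by
    intro i j hij
    by_contra hne
    exact h.2 i j hne (x i) (hx i) (hij ▸ hx j)
  have hcard : (Finset.univ.image x).card = n := by
    rw [Finset.card_image_of_injective _ hinj]; simp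
  have hsub : Finset.univ.image x ⊆ C := by
    intro e he
    obtain ⟨i, -, rfl⟩ := Finset.mem_image.1 he
    exact hC _ (hx1 i) (hx2 i)
  refine ⟨?_, ?_⟩
  · rw [← hcard]; exact Finset.card_le_card hsub
  · intro hle e he
    rw [← Finset.eq_of_subset_of_card_le hsub (by omega)] at he
    obtain ⟨i, -, rfl⟩ := Finset.mem_image.1 he
    exact ⟨i, hx i⟩

theorem infix_of_mem {G : MultiDigraph} {u v : G.V} {p : List G.E} (h : G.IsPathFrom u v p)
    {f : G.E} (hf : f ∈ p) (hd : G.dst f ≠ v) : ∃ e, G.dst f = G.src e ∧ [f, e] <:+: p := by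
  obtain ⟨s, t, rfl⟩ := List.append_of_mem hf
  obtain ⟨_, h2, _, h4⟩ := h
  have h2' : List.IsChain (fun e f => G.dst e = G.src f) (s ++ f :: t) := h2
  cases t with
  | nil => simp at h4; exact absurd h4 hd
  | cons e t =>
    have h3 := h2'.right_of_append
    rw [List.isChain_cons_cons] at h3
    exact ⟨e, h3.1, s, t, by simp⟩

def cutF (U : ℕ) : Finset (Fin 39) :=
  Finset.univ.filter fun e => U.testBit (xsrc e) = true ∧ ¬ U.testBit (xdst e) = true

theorem mem_cutF {U : ℕ} {e : Fin 39} (h1 : U.testBit (xsrc e) = true)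
    (h2 : ¬ U.testBit (xdst e) = true) : e ∈ cutF U :=
  Finset.mem_filter.2 ⟨Finset.mem_univ _, h1, h2⟩

theorem forced (U : ℕ) (v : Fin 25) (hu : U.testBit 0 = true) (hv : ¬ U.testBit v = true)
    (hc : (cutF U).card = 4) {α : Fin 4 → List (Fin 39)}
    (h : XG.MengerSystem (0 : Fin 25) v 4 α) {f e : Fin 39} (hf : f ∈ cutF U)
    (hfd : xdst f ≠ v) (hfe : ∀ e', xdst f = xsrc e' → e' = e) : ∃ i, [f, e] <:+: α i := by
  obtain ⟨i, hi⟩ := (cut_inj (G := XG) (fun w : Fin 25 => U.testBit w = true) (0 : Fin 25) v hu hv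
    (cutF U) (fun e h1 h2 => mem_cutF h1 h2) h).2 hc.le f hf
  obtain ⟨e', h1, h2⟩ := infix_of_mem (h.1 i) hi hfd
  have := hfe e' h1
  subst this
  exact ⟨i, h2⟩

theorem XA : ∀ k : Fin 9, (xua k).testBit 0 = true ∧ ¬ (xua k).testBit (23 : Fin 25) = true ∧
    (cutF (xua k)).card = 4 ∧ xfa k ∈ cutF (xua k) ∧ xdst (xfa k) ≠ 23 ∧
    (∀ e', xdst (xfa k) = xsrc e' → e' = xe k) := by
  decide +kernel

theorem XB : ∀ k : Fin 9, (xub k).testBit 0 = true ∧ ¬ (xub k).testBit (24 : Fin 25) = true ∧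
    (cutF (xub k)).card = 4 ∧ xfb k ∈ cutF (xub k) ∧ xdst (xfb k) ≠ 24 ∧
    (∀ e', xdst (xfb k) = xsrc e' → e' = xe k) := by
  decide +kernel

theorem Xne : ∀ k : Fin 9, xfa k ≠ xfb k := by decide +kernel

theorem Xe_inj : Function.Injective xe := by decide +kernel

theorem Xpa : (∀ i, xpa i ≠ [] ∧ List.IsChain (fun e f => xdst e = xsrc f) (xpa i) ∧
    (∀ e ∈ (xpa i).head?, xsrc e = 0) ∧ ∀ e ∈ (xpa i).getLast?, xdst e = 23) ∧
    ∀ i j, i ≠ j → ∀ e, e ∈ xpa i → e ∉ xpa j := by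
  decide +kernel

theorem Xpb : (∀ i, xpb i ≠ [] ∧ List.IsChain (fun e f => xdst e = xsrc f) (xpb i) ∧
    (∀ e ∈ (xpb i).head?, xsrc e = 0) ∧ ∀ e ∈ (xpb i).getLast?, xdst e = 24) ∧
    ∀ i j, i ≠ j → ∀ e, e ∈ xpb i → e ∉ xpb j := by
  decide +kernel

theorem Xcut : (cutF 1).card = 4 := by decide +kernel

theorem Xmin (v : Fin 25) (hv : ¬ Nat.testBit 1 v = true) :
    ¬∃ α : Fin (4 + 1) → List XG.E, XG.MengerSystem (0 : Fin 25) v (4 + 1) α := by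
  rintro ⟨α, h⟩
  have := (cut_inj (G := XG) (fun w : Fin 25 => Nat.testBit 1 w = true) (0 : Fin 25) v (by decide) hv
    (cutF 1) (fun e h1 h2 => mem_cutF h1 h2) h).1
  have h2 : 4 + 1 ≤ (cutF 1).card := this
  have h3 := Xcut
  omega

theorem Xrk : ∀ e : Fin 39, (xsrc e).val < (xdst e).val := by decide +kernel

theorem lower : MstarAtLeast ![4, 4] 9 := by
  refine ⟨XG, fun _ => (0 : Fin 25), (![23, 24] : Fin 2 → Fin 25), ⟨?_, ?_, ?_⟩, fun _ _ => rfl, ?_⟩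
  · intro v p hp
    exact lt_irrefl _ (path_rank (G := XG) (r := fun w : Fin 25 => w.val) Xrk v p v hp)
  · show Function.Injective (![23, 24] : Fin 2 → Fin 25)
    decide
  · intro i
    match i with
    | 0 => exact ⟨⟨xpa, Xpa⟩, Xmin 23 (by decide)⟩
    | 1 => exact ⟨⟨xpb, Xpb⟩, Xmin 24 (by decide)⟩
  · intro α hα
    have h0 : XG.MengerSystem (0 : Fin 25) (23 : Fin 25) 4 (α 0) := hα 0
    have h1 : XG.MengerSystem (0 : Fin 25) (24 : Fin 25) 4 (α 1) := hα 1
    have hsub : Set.range xe ⊆ {e : XG.E | XG.MergingEdge α e} := by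
      rintro _ ⟨k, rfl⟩
      obtain ⟨a1, a2, a3, a4, a5, a6⟩ := XA k
      obtain ⟨b1, b2, b3, b4, b5, b6⟩ := XB k
      obtain ⟨i, hi⟩ := forced _ _ a1 a2 a3 h0 a4 a5 a6
      obtain ⟨j, hj⟩ := forced _ _ b1 b2 b3 h1 b4 b5 b6
      exact ⟨0, 1, by decide, i, j, xfa k, xfb k, Xne k, hi, hj⟩
    have hfin : {e : XG.E | XG.MergingEdge α e}.Finite := by
      have : Finite XG.E := inferInstanceAs (Finite (Fin 39))
      exact Set.toFinite _
    have hle := Set.ncard_le_ncard hsub hfin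
    have h9 : (Set.range xe).ncard = 9 := by
      rw [← Set.image_univ, Set.ncard_image_of_injective _ Xe_inj, Set.ncard_univ]
      simp
    exact h9.symm.le.trans hle

end MS

/-- `M*(4, 4) = 9`. -/
theorem Mstar_four_four : MstarEq ![4, 4] 9 := by
  exact ⟨MS.upper, MS.lower⟩
end
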